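/- arXiv:2207.07946 — 3 statements merged into one kernel-verified Lean document; each statement's English description precedes it below -/
import Mathlib

section
/- The second-order blow-up suffices to attain the non-commutative rank of the matrix representation of fractional linear matroid parity: max_{y ∈ P} |y| = (1/4) · rank A^{(2)}, where A^{(2)} is the second-order blow-up of the matrix representation A. -/
open Matrix

noncomputable section

/-- Wedge product `a ∧ b = a bᵀ − b aᵀ`. -/
def wedge {K : Type*} [Field K] {n : ℕ} (a b : Fin n → K) : Matrix (Fin n) (Fin n) K :=
  vecMulVec a b - vecMulVec b a

/-- The line spanned by `a` and `b`. -/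
def line {K : Type*} [Field K] {n : ℕ} (a b : Fin n → K) : Submodule K (Fin n → K) :=
  Submodule.span K {a, b}

/-- `y` is a fractional matroid matching for the lines `ℓᵢ = span {aᵢ, bᵢ}`:
`y ≥ 0` and `∑ᵢ dim(S ⊓ ℓᵢ) yᵢ ≤ dim S` for every subspace `S`. -/
def IsFracMatching {K : Type*} [Field K] {n m : ℕ} (a b : Fin m → Fin n → K)
    (y : Fin m → ℝ) : Prop :=
  (∀ i, 0 ≤ y i) ∧ ∀ S : Submodule K (Fin n → K),
    ∑ i, (Module.finrank K ↥(S ⊓ line (a i) (b i)) : ℝ) * y i ≤ (Module.finrank K ↥S : ℝ)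

/-- The rational function field generated over `K` by the entries of the `d × d`
indeterminate matrices `X₁, …, X_m`. -/
abbrev FF (K : Type*) [Field K] (m d : ℕ) : Type _ :=
  FractionRing (MvPolynomial (Fin m × Fin d × Fin d) K)

def toFF (K : Type*) [Field K] (m d : ℕ) : K →+* FF K m d :=
  (algebraMap (MvPolynomial (Fin m × Fin d × Fin d) K) (FF K m d)).comp MvPolynomial.C

/-- The `d`-th order blow-up `A^{(d)} = ∑ᵢ Xᵢ ⊗ (aᵢ ∧ bᵢ)` of the matrix
representation `A = ∑ᵢ xᵢ (aᵢ ∧ bᵢ)`. -/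
def blowup {K : Type*} [Field K] {n m : ℕ} (a b : Fin m → Fin n → K) (d : ℕ) :
    Matrix (Fin d × Fin n) (Fin d × Fin n) (FF K m d) :=
  ∑ i : Fin m,
    kroneckerMap (· * ·)
      (Matrix.of fun p q : Fin d =>
        algebraMap (MvPolynomial (Fin m × Fin d × Fin d) K) (FF K m d) (MvPolynomial.X (i, p, q)))
      ((wedge (a i) (b i)).map (toFF K m d))

/-- The subspace orthogonal to `S` for the dot product. -/
def dotPerp {L ι : Type*} [Field L] [Fintype ι] (S : Submodule L (ι → L)) :
    Submodule L (ι → L) where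
  carrier := {x | ∀ c ∈ S, c ⬝ᵥ x = 0}
  add_mem' hx hy c hc := by rw [dotProduct_add, hx c hc, hy c hc, add_zero]
  zero_mem' c _ := dotProduct_zero c
  smul_mem' r x hx c hc := by rw [dotProduct_smul, hx c hc, smul_zero]

section DotPerp

variable {L ι : Type*} [Field L] [Fintype ι]

lemma mem_dotPerp {S : Submodule L (ι → L)} {x : ι → L} :
    x ∈ dotPerp S ↔ ∀ c ∈ S, c ⬝ᵥ x = 0 := Iff.rfl

lemma dotPerp_anti {S T : Submodule L (ι → L)} (h : S ≤ T) : dotPerp T ≤ dotPerp S :=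
  fun _ hx c hc => hx c (h hc)

lemma finrank_dotPerp (S : Submodule L (ι → L)) :
    Module.finrank L (dotPerp S) + Module.finrank L S = Fintype.card ι := by
  classical
  have h : dotPerp S = (S.dualAnnihilator).comap (dotProductEquiv L ι).toLinearMap := by
    ext x
    simp only [mem_dotPerp, Submodule.mem_comap, Submodule.mem_dualAnnihilator]
    refine forall₂_congr fun c _ => ?_
    rw [dotProduct_comm]
    rfl
  have h2 : Module.finrank L (dotPerp S) = Module.finrank L S.dualAnnihilator := by
    rw [h]
    exact LinearEquiv.finrank_eq
      (LinearEquiv.ofSubmodule' (dotProductEquiv L ι) S.dualAnnihilator)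
  rw [h2, add_comm, Subspace.finrank_add_finrank_dualAnnihilator_eq, Module.finrank_pi]

lemma dotPerp_dotPerp (S : Submodule L (ι → L)) : dotPerp (dotPerp S) = S := by
  refine (Submodule.eq_of_le_of_finrank_eq (fun x hx c hc => ?_) ?_).symm
  · rw [dotProduct_comm]; exact hc x hx
  · have h1 := finrank_dotPerp S
    have h2 := finrank_dotPerp (dotPerp S)
    omega

lemma dotPerp_sup (S T : Submodule L (ι → L)) :
    dotPerp (S ⊔ T) = dotPerp S ⊓ dotPerp T := by
  refine le_antisymm (le_inf (dotPerp_anti le_sup_left) (dotPerp_anti le_sup_right)) ?_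
  rintro x ⟨hS, hT⟩ c hc
  obtain ⟨s, hs, u, hu, rfl⟩ := Submodule.mem_sup.1 hc
  rw [add_dotProduct, hS s hs, hT u hu, add_zero]

lemma exists_vecMul_eq_of_forall_ker {κ : Type*} [Fintype κ] (M : Matrix κ ι L) (w : ι → L)
    (h : ∀ v, M *ᵥ v = 0 → w ⬝ᵥ v = 0) : ∃ s, s ᵥ* M = w := by
  have hw : w ∈ dotPerp (dotPerp (LinearMap.range M.vecMulLinear)) := by
    intro v hv
    rw [dotProduct_comm]
    refine h v (funext fun i => ?_)
    classical
    have hi : M.row i ⬝ᵥ v = 0 := by simpa using hv _ ⟨Pi.single i 1, rfl⟩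
    exact hi
  rw [dotPerp_dotPerp] at hw
  exact hw

end DotPerp

/-- The vectors indexed by `κ × ι` all of whose blocks lie in `S`. -/
def blocks {L ι : Type*} [Field L] (κ : Type*) (S : Submodule L (ι → L)) :
    Submodule L (κ × ι → L) where
  carrier := {v | ∀ q, (fun j => v (q, j)) ∈ S}
  add_mem' hx hy q := S.add_mem (hx q) (hy q)
  zero_mem' _ := S.zero_mem
  smul_mem' r _ hx q := S.smul_mem r (hx q)

lemma finrank_blocks {L ι : Type*} [Field L] [Finite ι] (κ : Type*) [Fintype κ]
    (S : Submodule L (ι → L)) :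
    Module.finrank L (blocks κ S) = Fintype.card κ * Module.finrank L S := by
  let e : blocks κ S ≃ₗ[L] (κ → S) :=
    { toFun := fun v q => ⟨fun j => v.1 (q, j), v.2 q⟩
      invFun := fun u => ⟨fun p => (u p.1).1 p.2, fun q => (u q).2⟩
      map_add' := fun _ _ => rfl
      map_smul' := fun _ _ => rfl
      left_inv := fun _ => rfl
      right_inv := fun _ => rfl }
  rw [e.finrank_eq, Module.finrank_pi_fintype]
  simp

/-- The matrix `∑ₖ Xₖ ⊗ (aₖ ∧ bₖ)`, given entrywise. -/
def blockMatrix {R : Type*} [CommRing R] {n m d : ℕ} (X : Fin m → Matrix (Fin d) (Fin d) R)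
    (a b : Fin m → Fin n → R) : Matrix (Fin d × Fin n) (Fin d × Fin n) R :=
  Matrix.of fun p i => ∑ k, X k p.1 i.1 * (a k p.2 * b k i.2 - b k p.2 * a k i.2)

lemma blockMatrix_mulVec {R : Type*} [CommRing R] {n m d : ℕ}
    (X : Fin m → Matrix (Fin d) (Fin d) R) (a b : Fin m → Fin n → R) (v : Fin d × Fin n → R)
    (p : Fin d × Fin n) :
    (blockMatrix X a b *ᵥ v) p = ∑ k, ∑ r, X k p.1 r *
      (a k p.2 * (b k ⬝ᵥ fun j => v (r, j)) - b k p.2 * (a k ⬝ᵥ fun j => v (r, j))) := by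
  simp only [mulVec, dotProduct, blockMatrix, of_apply, Fintype.sum_prod_type, Finset.sum_mul]
  rw [Finset.sum_congr rfl fun r _ => Finset.sum_comm, Finset.sum_comm]
  refine Finset.sum_congr rfl fun k _ => Finset.sum_congr rfl fun r _ => ?_
  simp only [Finset.mul_sum, ← Finset.sum_sub_distrib]
  exact Finset.sum_congr rfl fun j _ => by ring

/-- Blocks `X` over a field `L` together with partial derivations and a twist `σ` that detect that
the entries of `X` are generic, while `a` and `b` are constant for both. -/
structure GenericBlocks (K : Type*) {L : Type*} [Field K] [Field L] [Algebra K L]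
    {n m : ℕ} (a b : Fin m → Fin n → L) where
  X : Fin m → Matrix (Fin 2) (Fin 2) L
  D : Fin m → Fin 2 → Fin 2 → Derivation K L L
  σ : L →+* L
  t : L
  D_X : ∀ k q r k' q' r', D k q r (X k' q' r') = if k' = k ∧ q' = q ∧ r' = r then 1 else 0
  D_a : ∀ k q r i j, D k q r (a i j) = 0
  D_b : ∀ k q r i j, D k q r (b i j) = 0
  σ_a : ∀ i j, σ (a i j) = a i j
  σ_b : ∀ i j, σ (b i j) = b i j
  σ_X₀₀ : ∀ k, σ (X k 0 0) = X k 1 1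
  σ_X₁₁ : ∀ k, σ (X k 1 1) = X k 0 0
  σ_X₀₁ : ∀ k, t * σ (X k 0 1) = X k 1 0
  σ_X₁₀ : ∀ k, σ (X k 1 0) = t * X k 0 1
  not_norm : ∀ ρ, ρ * σ ρ ≠ t

namespace GenericBlocks

variable {K L : Type*} [Field K] [Field L] [Algebra K L] {n m : ℕ} {a b : Fin m → Fin n → L}
  (G : GenericBlocks K a b)

/-- The generic block matrix. -/
abbrev M : Matrix (Fin 2 × Fin n) (Fin 2 × Fin n) L := blockMatrix G.X a b

/-- `G.Kills c` says that `c` annihilates both blocks of every kernel vector. -/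
def Kills (c : Fin n → L) : Prop :=
  ∀ v, G.M *ᵥ v = 0 → ∀ q, (c ⬝ᵥ fun j => v (q, j)) = 0

/-- The semilinear symmetry of the kernel. -/
def twist (v : Fin 2 × Fin n → L) : Fin 2 × Fin n → L :=
  fun p => if p.1 = 0 then G.σ (v (1, p.2)) else G.t * G.σ (v (0, p.2))

lemma twist_mem {v : Fin 2 × Fin n → L} (hv : G.M *ᵥ v = 0) : G.M *ᵥ G.twist v = 0 := by
  have h0 : ∀ j, G.σ ((G.M *ᵥ v) (0, j)) = 0 := fun j => by rw [hv]; simp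
  have h1 : ∀ j, G.σ ((G.M *ᵥ v) (1, j)) = 0 := fun j => by rw [hv]; simp
  simp only [M, blockMatrix_mulVec, map_sum, map_add, map_mul, map_sub, Fin.sum_univ_two, G.σ_a, G.σ_b,
    G.σ_X₀₀, G.σ_X₁₁, G.σ_X₁₀, dotProduct] at h0 h1
  have key : ∀ (c : Fin n → L),
      ((∑ j, c j * G.twist v (0, j)) = ∑ j, c j * G.σ (v (1, j))) ∧
      ((∑ j, c j * G.twist v (1, j)) = G.t * ∑ j, c j * G.σ (v (0, j))) := by
    intro c
    refine ⟨by simp [twist], ?_⟩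
    rw [Finset.mul_sum]
    exact Finset.sum_congr rfl fun j _ => by simp only [twist]; simp; ring
  ext ⟨p, j⟩
  simp only [M, blockMatrix_mulVec, Fin.sum_univ_two, dotProduct, key, Pi.zero_apply]
  fin_cases p
  · simp only [Fin.zero_eta]
    rw [← h1 j]
    exact Finset.sum_congr rfl fun k _ => by ring
  · simp only [Fin.mk_one]
    rw [← mul_zero G.t, ← h0 j, Finset.mul_sum]
    refine Finset.sum_congr rfl fun k _ => ?_
    rw [← G.σ_X₀₁ k]
    ring

lemma kills_of_dependent {c : Fin n → L} (hc : ∀ j, G.σ (c j) = c j) {κ : Fin 2 → L} (hκ : κ ≠ 0)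
    (h : ∀ v, G.M *ᵥ v = 0 → (∑ q, κ q * (c ⬝ᵥ fun j => v (q, j))) = 0) : G.Kills c := by
  intro v hv
  have e1 := h v hv
  have e2 := h _ (G.twist_mem hv)
  have t0 : (c ⬝ᵥ fun j => G.twist v (0, j)) = G.σ (c ⬝ᵥ fun j => v (1, j)) := by
    simp [dotProduct, twist, hc]
  have t1 : (c ⬝ᵥ fun j => G.twist v (1, j)) = G.t * G.σ (c ⬝ᵥ fun j => v (0, j)) := by
    simp only [dotProduct, map_sum, map_mul, hc, Finset.mul_sum]
    exact Finset.sum_congr rfl fun j _ => by simp only [twist]; simp; ring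
  rw [Fin.sum_univ_two] at e1 e2
  rw [t0, t1] at e2
  generalize hx0 : (c ⬝ᵥ fun j => v (0, j)) = x at *
  generalize hy : (c ⬝ᵥ fun j => v (1, j)) = y at *
  have hdet : G.t * (x * G.σ x) = y * G.σ y := by
    by_contra hne
    refine hκ (funext fun q => ?_)
    have hne' : G.t * (x * G.σ x) - y * G.σ y ≠ 0 := sub_ne_zero.2 hne
    have k0 : κ 0 * (G.t * (x * G.σ x) - y * G.σ y) = 0 := by
      linear_combination (G.t * G.σ x) * e1 - y * e2
    have k1 : κ 1 * (G.t * (x * G.σ x) - y * G.σ y) = 0 := by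
      linear_combination x * e2 - G.σ y * e1
    fin_cases q
    · exact (mul_eq_zero.1 k0).resolve_right hne'
    · exact (mul_eq_zero.1 k1).resolve_right hne'
  have hx : x = 0 := by
    by_contra hx
    have hσ : G.σ x ≠ 0 := (map_ne_zero G.σ).2 hx
    refine G.not_norm (y / x) ?_
    rw [map_div₀]
    field_simp
    rw [← hdet]
    ring
  have hy0 : y = 0 := by
    rw [hx, map_zero, mul_zero, mul_zero, eq_comm] at hdet
    rcases mul_eq_zero.1 hdet with h | h
    · exact h
    · exact (map_eq_zero G.σ).1 h
  intro q
  fin_cases q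
  · exact hx0.trans hx
  · exact hy.trans hy0

lemma sum_D_vecMul_mul (z v : Fin 2 × Fin n → L) (hv : G.M *ᵥ v = 0) (k : Fin m) (q r : Fin 2) :
    ∑ i, G.D k q r ((z ᵥ* G.M) i) * v i =
      (a k ⬝ᵥ fun j => z (q, j)) * (b k ⬝ᵥ fun j => v (r, j)) -
      (b k ⬝ᵥ fun j => z (q, j)) * (a k ⬝ᵥ fun j => v (r, j)) := by
  have hM : ∀ p i, G.D k q r (G.M p i) =
      if p.1 = q ∧ i.1 = r then a k p.2 * b k i.2 - b k p.2 * a k i.2 else 0 := by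
    intro p i
    simp only [M, blockMatrix, of_apply, map_sum, Derivation.leibniz, map_sub, G.D_X, G.D_a,
      G.D_b, smul_eq_mul, mul_zero, add_zero, sub_zero, zero_add]
    rw [Finset.sum_eq_single k]
    · by_cases h : p.1 = q ∧ i.1 = r <;> simp [h]
    · intro k' _ hk
      simp [hk]
    · simp
  have h1 : ∀ i, G.D k q r ((z ᵥ* G.M) i) =
      ((fun p => G.D k q r (z p)) ᵥ* G.M) i + (z ᵥ* (G.M.map (G.D k q r))) i := by
    intro i
    simp only [vecMul, dotProduct, map_sum, Derivation.leibniz, smul_eq_mul, map_apply,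
      ← Finset.sum_add_distrib]
    exact Finset.sum_congr rfl fun p _ => by ring
  calc _ = ((fun p => G.D k q r (z p)) ᵥ* G.M) ⬝ᵥ v + (z ᵥ* (G.M.map (G.D k q r))) ⬝ᵥ v := by
        simp only [h1, add_mul, Finset.sum_add_distrib, dotProduct]
    _ = z ⬝ᵥ (G.M.map (G.D k q r) *ᵥ v) := by
        rw [← dotProduct_mulVec, hv, dotProduct_zero, zero_add, ← dotProduct_mulVec]
    _ = _ := by
        have h2 : ∀ p, (G.M.map (G.D k q r) *ᵥ v) p = if p.1 = q then
            a k p.2 * (b k ⬝ᵥ fun j => v (r, j)) - b k p.2 * (a k ⬝ᵥ fun j => v (r, j))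
            else 0 := by
          intro p
          simp only [mulVec, dotProduct, map_apply, hM, Fintype.sum_prod_type]
          rw [Finset.sum_eq_single r]
          · by_cases h : p.1 = q
            · simp only [h, and_self, if_true, Finset.mul_sum, ← Finset.sum_sub_distrib]
              exact Finset.sum_congr rfl fun j _ => by ring
            · simp [h]
          · intro r' _ hr
            simp [hr]
          · simp
        simp only [dotProduct, h2, Fintype.sum_prod_type]
        rw [Finset.sum_eq_single q]
        · simp only [if_true, Finset.sum_mul, ← Finset.sum_sub_distrib]
          exact Finset.sum_congr rfl fun j _ => by ring
        · intro q' _ hq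
          simp [hq]
        · simp

/-- The span of the constant vectors annihilating the kernel. -/
def constAnn : Submodule L (Fin n → L) :=
  Submodule.span L {c | (∀ k q r j, G.D k q r (c j) = 0) ∧ G.Kills c}

lemma kills_of_mem_constAnn {c : Fin n → L} (hc : c ∈ G.constAnn) : G.Kills c := by
  intro v hv q
  induction hc using Submodule.span_induction with
  | mem c hc => exact hc.2 v hv q
  | zero => exact zero_dotProduct _
  | add x y _ _ hx hy => rw [add_dotProduct, hx, hy, add_zero]
  | smul r x _ hx => rw [smul_dotProduct, hx, smul_zero]

lemma D_mem_constAnn {c : Fin n → L} (hc : c ∈ G.constAnn) (k : Fin m) (q r : Fin 2) :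
    (fun j => G.D k q r (c j)) ∈ G.constAnn := by
  induction hc using Submodule.span_induction with
  | mem c hc =>
    simp only [hc.1]
    exact G.constAnn.zero_mem
  | zero =>
    simp only [Pi.zero_apply, map_zero]
    exact G.constAnn.zero_mem
  | add x y _ _ hx hy =>
    simp only [Pi.add_apply, map_add]
    exact G.constAnn.add_mem hx hy
  | smul s x h hx =>
    simp only [Pi.smul_apply, smul_eq_mul, Derivation.leibniz]
    exact G.constAnn.add_mem (G.constAnn.smul_mem s hx)
      (by simpa [Pi.smul_def, mul_comm] using G.constAnn.smul_mem (G.D k q r s) h)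

lemma exists_vecMul_eq_of_kills {c : Fin n → L} (hc : G.Kills c) (p : Fin 2) :
    ∃ s, s ᵥ* G.M = fun i => if i.1 = p then c i.2 else 0 := by
  refine exists_vecMul_eq_of_forall_ker _ _ fun v hv => ?_
  refine Eq.trans ?_ (hc v hv p)
  simp only [dotProduct, Fintype.sum_prod_type, ite_mul, zero_mul]
  rw [Finset.sum_eq_single p (fun q _ hq => by simp [hq]) (by simp)]
  simp

lemma D_eq_zero_of_kills_sub {j : Fin m} {l : L} (h : G.Kills (b j - l • a j))
    (ha : ¬ G.Kills (a j)) (k : Fin m) (q r : Fin 2) : G.D k q r l = 0 := by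
  choose s hs using G.exists_vecMul_eq_of_kills h
  have key : ∀ (p r : Fin 2) (v : Fin 2 × Fin n → L), G.M *ᵥ v = 0 →
      -(G.D k q r l * (a j ⬝ᵥ fun i => v (p, i))) =
      (a k ⬝ᵥ fun j => s p (q, j)) * (b k ⬝ᵥ fun j => v (r, j)) -
      (b k ⬝ᵥ fun j => s p (q, j)) * (a k ⬝ᵥ fun j => v (r, j)) := by
    intro p r v hv
    rw [← G.sum_D_vecMul_mul (s p) v hv k q r, hs p]
    simp only [Fintype.sum_prod_type, Pi.sub_apply, Pi.smul_apply, smul_eq_mul]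
    rw [Finset.sum_eq_single p (fun q _ hq => by simp [hq]) (by simp)]
    simp only [if_true, map_sub, Derivation.leibniz, G.D_a, G.D_b, dotProduct, Finset.mul_sum,
      smul_eq_mul, mul_zero, zero_add, zero_sub, ← Finset.sum_neg_distrib]
    exact Finset.sum_congr rfl fun i _ => by ring
  by_contra hr
  apply ha
  generalize hα : (fun p => a k ⬝ᵥ fun j => s p (q, j)) = α at *
  generalize hβ : (fun p => b k ⬝ᵥ fun j => s p (q, j)) = β at *
  have hα' : ∀ p, (a k ⬝ᵥ fun j => s p (q, j)) = α p := fun p => congrFun hα p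
  have hβ' : ∀ p, (b k ⬝ᵥ fun j => s p (q, j)) = β p := fun p => congrFun hβ p
  simp only [hα', hβ'] at key
  by_cases hdet : α 0 * β 1 - α 1 * β 0 = 0
  · obtain ⟨μ, hμ, h1, h2⟩ : ∃ μ : Fin 2 → L, μ ≠ 0 ∧ μ 0 * α 0 + μ 1 * α 1 = 0 ∧
        μ 0 * β 0 + μ 1 * β 1 = 0 := by
      obtain ⟨μ, hμ, h⟩ := Matrix.exists_vecMul_eq_zero_iff.2
        (show (Matrix.of ![![α 0, β 0], ![α 1, β 1]]).det = 0 by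
          rw [Matrix.det_fin_two]; simp; linear_combination hdet)
      refine ⟨μ, hμ, ?_, ?_⟩
      · simpa [vecMul, dotProduct, Fin.sum_univ_two] using congrFun h 0
      · simpa [vecMul, dotProduct, Fin.sum_univ_two] using congrFun h 1
    refine G.kills_of_dependent (G.σ_a j) hμ fun v hv => ?_
    have e0 := key 0 r v hv
    have e1 := key 1 r v hv
    rw [Fin.sum_univ_two]
    refine (mul_eq_zero.1 (?_ : G.D k q r l * _ = 0)).resolve_left hr
    linear_combination -μ 0 * e0 - μ 1 * e1 - (b k ⬝ᵥ fun j => v (r, j)) * h1 +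
      (a k ⬝ᵥ fun j => v (r, j)) * h2
  · have hκ : (![G.D k q 1 l, -G.D k q 0 l] : Fin 2 → L) ≠ 0 := by
      intro h0
      have h00 := congrFun h0 0
      have h01 := congrFun h0 1
      simp only [cons_val_zero, cons_val_one, Pi.zero_apply, neg_eq_zero] at h00 h01
      fin_cases r
      · exact hr h01
      · exact hr h00
    have hbk : G.Kills (b k) := by
      refine G.kills_of_dependent (G.σ_b k) hκ fun v hv => ?_
      have e00 := key 0 0 v hv
      have e01 := key 0 1 v hv
      have e10 := key 1 0 v hv
      have e11 := key 1 1 v hv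
      rw [Fin.sum_univ_two]
      simp only [cons_val_zero, cons_val_one]
      refine (mul_eq_zero.1 (?_ : (α 0 * β 1 - α 1 * β 0) * _ = 0)).resolve_left hdet
      linear_combination (-β 1 * G.D k q 1 l) * e00 + β 1 * G.D k q 0 l * e01 +
        β 0 * G.D k q 1 l * e10 - β 0 * G.D k q 0 l * e11
    have hak : G.Kills (a k) := by
      refine G.kills_of_dependent (G.σ_a k) hκ fun v hv => ?_
      have e00 := key 0 0 v hv
      have e01 := key 0 1 v hv
      have e10 := key 1 0 v hv
      have e11 := key 1 1 v hv
      rw [Fin.sum_univ_two]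
      simp only [cons_val_zero, cons_val_one]
      refine (mul_eq_zero.1 (?_ : (α 0 * β 1 - α 1 * β 0) * _ = 0)).resolve_left hdet
      linear_combination (-α 1 * G.D k q 1 l) * e00 + α 1 * G.D k q 0 l * e01 +
        α 0 * G.D k q 1 l * e10 - α 0 * G.D k q 0 l * e11
    intro v hv p
    have e := key p r v hv
    rw [hbk v hv, hak v hv, mul_zero, mul_zero, sub_zero, neg_eq_zero] at e
    exact (mul_eq_zero.1 e).resolve_left hr

lemma mem_constAnn_of_kills {j : Fin m} {x y : L} (h : G.Kills (x • b j - y • a j)) :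
    x • b j - y • a j ∈ G.constAnn := by
  have hA : G.Kills (a j) → a j ∈ G.constAnn := fun h =>
    Submodule.subset_span ⟨fun k q r i => G.D_a k q r j i, h⟩
  have hB : G.Kills (b j) → b j ∈ G.constAnn := fun h =>
    Submodule.subset_span ⟨fun k q r i => G.D_b k q r j i, h⟩
  by_cases ha : G.Kills (a j)
  · refine G.constAnn.sub_mem ?_ (G.constAnn.smul_mem _ (hA ha))
    by_cases hx : x = 0
    · rw [hx, zero_smul]; exact G.constAnn.zero_mem
    refine G.constAnn.smul_mem _ (hB fun v hv q => ?_)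
    have := h v hv q
    rw [sub_dotProduct, smul_dotProduct, smul_dotProduct, ha v hv q, smul_zero, sub_zero] at this
    exact (smul_eq_zero.1 this).resolve_left hx
  · by_cases hx : x = 0
    · subst hx
      by_cases hy : y = 0
      · subst hy
        simp
      refine absurd (fun v hv q => ?_) ha
      have := h v hv q
      rw [zero_smul, zero_sub, neg_dotProduct, smul_dotProduct, neg_eq_zero] at this
      exact (smul_eq_zero.1 this).resolve_left hy
    · have hfac : x • b j - y • a j = x • (b j - (y / x) • a j) := by
        rw [smul_sub, smul_smul, mul_div_cancel₀ _ hx]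
      rw [hfac] at h ⊢
      have h' : G.Kills (b j - (y / x) • a j) := fun v hv q => by
        have := h v hv q
        rw [smul_dotProduct] at this
        exact (smul_eq_zero.1 this).resolve_left hx
      refine G.constAnn.smul_mem _ (Submodule.subset_span ⟨fun k q r i => ?_, h'⟩)
      simp [Derivation.leibniz, G.D_a, G.D_b, G.D_eq_zero_of_kills_sub h' ha]

end GenericBlocks

/-- The linear map of the matrix `a ∧ b`. -/
def wedgeMap {L : Type*} [Field L] {n : ℕ} (a b : Fin n → L) : (Fin n → L) →ₗ[L] (Fin n → L) where
  toFun x := (b ⬝ᵥ x) • a - (a ⬝ᵥ x) • b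
  map_add' x y := by simp only [dotProduct_add, add_smul]; abel
  map_smul' r x := by
    simp only [dotProduct_smul, smul_eq_mul, mul_smul, RingHom.id_apply, smul_sub]

lemma finrank_line {L : Type*} [Field L] {n : ℕ} {a b : Fin n → L}
    (h : LinearIndependent L ![a, b]) : Module.finrank L (line a b) = 2 := by
  have := finrank_span_eq_card h
  rwa [range_cons, range_cons, range_empty, Set.union_empty, Fintype.card_fin] at this

lemma finrank_map_wedgeMap_dotPerp {L : Type*} [Field L] {n : ℕ} {a b : Fin n → L}
    (h : LinearIndependent L ![a, b]) (T : Submodule L (Fin n → L)) :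
    Module.finrank L ((dotPerp T).map (wedgeMap a b)) +
      Module.finrank L ↥(T ⊓ line a b) = 2 := by
  have hker : LinearMap.ker (wedgeMap a b) = dotPerp (line a b) := by
    ext x
    rw [LinearMap.mem_ker, mem_dotPerp]
    constructor
    · intro hx c hc
      have := (LinearIndependent.pair_iff.1 h) (b ⬝ᵥ x) (-(a ⬝ᵥ x))
        (by rw [neg_smul, ← sub_eq_add_neg]; exact hx)
      obtain ⟨u, v, rfl⟩ := Submodule.mem_span_pair.1 hc
      rw [add_dotProduct, smul_dotProduct, smul_dotProduct, this.1, neg_eq_zero.1 this.2]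
      simp
    · intro hx
      have hax := hx a (Submodule.subset_span (by simp))
      have hbx := hx b (Submodule.subset_span (by simp))
      simp [wedgeMap, hax, hbx]
  have h1 := LinearMap.finrank_range_add_finrank_ker ((wedgeMap a b).domRestrict (dotPerp T))
  have h2 : Module.finrank L (LinearMap.ker ((wedgeMap a b).domRestrict (dotPerp T))) =
      Module.finrank L (dotPerp (T ⊔ line a b)) := by
    rw [LinearMap.ker_domRestrict, hker, dotPerp_sup, ← Submodule.map_comap_subtype,
      Submodule.finrank_map_subtype_eq]
  rw [LinearMap.range_domRestrict, h2] at h1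
  have h3 := finrank_dotPerp T
  have h4 := finrank_dotPerp (T ⊔ line a b)
  have h5 := Submodule.finrank_sup_add_finrank_inf_eq T (line a b)
  rw [finrank_line h] at h5
  omega

namespace GenericBlocks

variable {K L : Type*} [Field K] [Field L] [Algebra K L] {n m : ℕ} {a b : Fin m → Fin n → L}
  (G : GenericBlocks K a b)

/-- The span of the images of `G.constAnn`'s orthogonal complement under the matrices
`aₖ ∧ bₖ`. -/
def spread : Submodule L (Fin n → L) :=
  ⨆ k, (dotPerp G.constAnn).map (wedgeMap (a k) (b k))

lemma dotProduct_wedgeMap_eq_zero {z : Fin 2 × Fin n → L}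
    (hz : z ᵥ* G.M ∈ blocks (Fin 2) G.constAnn) (q : Fin 2) (k : Fin m) {x : Fin n → L}
    (hx : x ∈ dotPerp G.constAnn) : (fun j => z (q, j)) ⬝ᵥ wedgeMap (a k) (b k) x = 0 := by
  have hK : G.Kills ((a k ⬝ᵥ fun j => z (q, j)) • b k - (b k ⬝ᵥ fun j => z (q, j)) • a k) := by
    intro v hv r
    rw [sub_dotProduct, smul_dotProduct, smul_dotProduct, smul_eq_mul, smul_eq_mul,
      ← G.sum_D_vecMul_mul z v hv, Fintype.sum_prod_type]
    exact Finset.sum_eq_zero fun p _ =>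
      G.kills_of_mem_constAnn (G.D_mem_constAnn (hz p) k q r) v hv p
  have := hx _ (G.mem_constAnn_of_kills hK)
  rw [sub_dotProduct, smul_dotProduct, smul_dotProduct, smul_eq_mul, smul_eq_mul] at this
  rw [dotProduct_comm _ (wedgeMap _ _ _)]
  simp only [wedgeMap, LinearMap.coe_mk, AddHom.coe_mk, sub_dotProduct, smul_dotProduct,
    smul_eq_mul]
  linear_combination this

lemma blocks_spread_le :
    blocks (Fin 2) G.spread ≤ (blocks (Fin 2) (dotPerp G.constAnn)).map G.M.mulVecLin := by
  rw [← dotPerp_dotPerp ((blocks (Fin 2) (dotPerp G.constAnn)).map G.M.mulVecLin)]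
  intro u hu z hz
  have hz' : z ᵥ* G.M ∈ blocks (Fin 2) G.constAnn := by
    intro q
    rw [← dotPerp_dotPerp G.constAnn]
    intro x hx
    have hmem : (fun p : Fin 2 × Fin n => if p.1 = q then x p.2 else 0) ∈
        blocks (Fin 2) (dotPerp G.constAnn) := by
      intro p
      by_cases h : p = q
      · simpa [h] using hx
      · simp only [h, if_false]
        exact (dotPerp G.constAnn).zero_mem
    have := hz _ (Submodule.mem_map_of_mem hmem)
    rw [mulVecLin_apply, dotProduct_comm, dotProduct_mulVec] at this
    rw [dotProduct_comm, ← this]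
    simp only [dotProduct, Fintype.sum_prod_type, mul_ite, mul_zero]
    rw [Finset.sum_eq_single q (fun p _ hp => by simp [hp]) (by simp)]
    simp
  have hperp : ∀ q, G.spread ≤ dotPerp (Submodule.span L {fun j => z (q, j)}) := by
    intro q
    refine iSup_le fun k => ?_
    rintro _ ⟨x, hx, rfl⟩ c hc
    obtain ⟨r, rfl⟩ := Submodule.mem_span_singleton.1 hc
    rw [smul_dotProduct, G.dotProduct_wedgeMap_eq_zero hz' q k hx, smul_zero]
  rw [dotProduct, Fintype.sum_prod_type]
  exact Finset.sum_eq_zero fun q _ =>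
    hperp q (hu q) _ (Submodule.mem_span_singleton_self _)

lemma two_mul_finrank_add_le :
    2 * (Module.finrank L G.spread + Module.finrank L G.constAnn) ≤ G.M.rank := by
  have h1 := Submodule.finrank_mono G.blocks_spread_le
  rw [finrank_blocks, Fintype.card_fin] at h1
  have h2 := LinearMap.finrank_range_add_finrank_ker
    (G.M.mulVecLin.domRestrict (blocks (Fin 2) (dotPerp G.constAnn)))
  have hle : LinearMap.ker G.M.mulVecLin ≤ blocks (Fin 2) (dotPerp G.constAnn) :=
    fun v hv q c hc => G.kills_of_mem_constAnn hc v hv q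
  have h3 : Module.finrank L
      (LinearMap.ker (G.M.mulVecLin.domRestrict (blocks (Fin 2) (dotPerp G.constAnn)))) =
      Module.finrank L (LinearMap.ker G.M.mulVecLin) := by
    rw [LinearMap.ker_domRestrict]
    exact (Submodule.comapSubtypeEquivOfLe hle).finrank_eq
  rw [LinearMap.range_domRestrict, h3, finrank_blocks, Fintype.card_fin] at h2
  have h4 := LinearMap.finrank_range_add_finrank_ker G.M.mulVecLin
  rw [Module.finrank_pi, Fintype.card_prod, Fintype.card_fin, Fintype.card_fin] at h4
  have h5 := finrank_dotPerp G.constAnn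
  rw [Fintype.card_fin] at h5
  change _ ≤ Module.finrank L (LinearMap.range G.M.mulVecLin)
  omega

lemma two_le_finrank_inf_line_add (k : Fin m) (h : LinearIndependent L ![a k, b k]) :
    2 ≤ Module.finrank L ↥(G.spread ⊓ line (a k) (b k)) +
      Module.finrank L ↥(G.constAnn ⊓ line (a k) (b k)) := by
  rw [← finrank_map_wedgeMap_dotPerp h G.constAnn]
  refine Nat.add_le_add_right (Submodule.finrank_mono (le_inf ?_ ?_)) _
  · exact le_iSup (fun k => (dotPerp G.constAnn).map (wedgeMap (a k) (b k))) k
  · rintro _ ⟨x, -, rfl⟩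
    exact Submodule.sub_mem _ (Submodule.smul_mem _ _ (Submodule.subset_span (by simp)))
      (Submodule.smul_mem _ _ (Submodule.subset_span (by simp)))

end GenericBlocks

lemma exists_derivation_fractionRing {K S : Type*} [CommRing K] [CommRing S] [Algebra K S]
    (d : Derivation K S S) : ∃ D : Derivation K (FractionRing S) (FractionRing S),
      ∀ s, D (algebraMap S _ s) = algebraMap S _ (d s) := by
  have : Algebra.FormallyEtale S (FractionRing S) :=
    Algebra.FormallyEtale.of_isLocalization (nonZeroDivisors S)
  let g : Ω[S⁄K] →ₗ[S] FractionRing S :=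
    ((Algebra.linearMap S (FractionRing S)).compDer d).liftKaehlerDifferential
  let h := KaehlerDifferential.isBaseChange_of_formallyEtale K S (FractionRing S)
  refine ⟨(h.lift g).compDer (KaehlerDifferential.D K (FractionRing S)), fun s => ?_⟩
  have e := h.lift_eq g (KaehlerDifferential.D K S s)
  rw [KaehlerDifferential.map_D] at e
  refine e.trans ?_
  exact Derivation.liftKaehlerDifferential_comp_D _ s

/-- The indeterminates: one for each entry of each `2 × 2` block and an extra one, `none`. -/
abbrev TwistVars (m : ℕ) : Type := Option (Fin m × Fin 2 × Fin 2)

/-- The permutation of the indeterminates reversing the rows and the columns of each block. -/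
def revVars (m : ℕ) : TwistVars m ≃ TwistVars m :=
  Equiv.optionCongr ((Equiv.refl _).prodCongr (Fin.revPerm.prodCongr Fin.revPerm))

/-- The rational functions in the entries of the blocks and the extra indeterminate. -/
abbrev TwistField (K : Type*) [Field K] (m : ℕ) : Type _ :=
  FractionRing (MvPolynomial (TwistVars m) K)

lemma mul_rename_ne {K : Type*} [Field K] {m : ℕ} {f g : MvPolynomial (TwistVars m) K}
    (hg : g ≠ 0) : f * MvPolynomial.rename (revVars m) f ≠
      MvPolynomial.X none * (g * MvPolynomial.rename (revVars m) g) := by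
  intro h
  have hdeg : ∀ f : MvPolynomial (TwistVars m) K,
      (MvPolynomial.rename (revVars m) f).totalDegree = f.totalDegree := fun f =>
    MvPolynomial.totalDegree_renameEquiv (revVars m) f
  have hinj := MvPolynomial.rename_injective (R := K) _ (revVars m).injective
  have hne : ∀ f : MvPolynomial (TwistVars m) K, f ≠ 0 →
      MvPolynomial.rename (revVars m) f ≠ 0 := fun f hf h0 =>
    hf (hinj (h0.trans (map_zero _).symm))
  have hgg := mul_ne_zero hg (hne g hg)
  have hf : f ≠ 0 := by
    rintro rfl
    rw [zero_mul] at h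
    exact mul_ne_zero (MvPolynomial.X_ne_zero _) hgg h.symm
  have := congrArg MvPolynomial.totalDegree h
  rw [MvPolynomial.totalDegree_mul_of_isDomain hf (hne f hf),
    MvPolynomial.totalDegree_mul_of_isDomain (MvPolynomial.X_ne_zero _) hgg,
    MvPolynomial.totalDegree_mul_of_isDomain hg (hne g hg), MvPolynomial.totalDegree_X,
    hdeg, hdeg] at this
  omega

/-- The entry `X (k, q, r)`, multiplied by the extra indeterminate when `(q, r) = (1, 0)`. -/
def twistVar (K : Type*) [Field K] {m : ℕ} (k : Fin m) (q r : Fin 2) :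
    MvPolynomial (TwistVars m) K :=
  (if q = 1 ∧ r = 0 then MvPolynomial.X none else 1) * MvPolynomial.X (some (k, q, r))

theorem nonempty_genericBlocks {K : Type*} [Field K] {n m : ℕ} (a b : Fin m → Fin n → K) :
    Nonempty (GenericBlocks K (fun i j => algebraMap K (TwistField K m) (a i j))
      (fun i j => algebraMap K (TwistField K m) (b i j))) := by
  choose D hD using fun i : TwistVars m =>
    exists_derivation_fractionRing (MvPolynomial.pderiv (R := K) i)
  have hinj := MvPolynomial.rename_injective (R := K) _ (revVars m).injective
  let σ : TwistField K m →+* TwistField K m :=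
    IsFractionRing.map (j := (MvPolynomial.rename (R := K) (revVars m)).toRingHom) hinj
  have hσ : ∀ f, σ (algebraMap _ _ f) = algebraMap _ _ (MvPolynomial.rename (revVars m) f) :=
    fun f => IsLocalization.map_eq _ f
  have hσC : ∀ c : K, σ (algebraMap K _ c) = algebraMap K _ c := fun c => by
    rw [IsScalarTower.algebraMap_apply K (MvPolynomial (TwistVars m) K) (TwistField K m), hσ]
    simp
  let t : TwistField K m := algebraMap _ _ (MvPolynomial.X none : MvPolynomial (TwistVars m) K)
  have ht : t ≠ 0 := by simp [t]
  let E : Fin m → Fin 2 → Fin 2 → Derivation K (TwistField K m) (TwistField K m) :=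
    fun k q r => (if q = 1 ∧ r = 0 then t⁻¹ else 1) • D (some (k, q, r))
  refine ⟨{
    X := fun k => Matrix.of fun q r => algebraMap _ (TwistField K m) (twistVar K k q r)
    D := E
    σ := σ
    t := t
    D_X := ?_
    D_a := fun k q r i j => (E k q r).map_algebraMap _
    D_b := fun k q r i j => (E k q r).map_algebraMap _
    σ_a := fun i j => hσC _
    σ_b := fun i j => hσC _
    σ_X₀₀ := fun k => ?_
    σ_X₁₁ := fun k => ?_
    σ_X₀₁ := fun k => ?_
    σ_X₁₀ := fun k => ?_
    not_norm := fun ρ => ?_ }⟩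
  · intro k q r k' q' r'
    have : D (some (k, q, r)) (algebraMap _ _ (twistVar K k' q' r')) =
        (if q' = 1 ∧ r' = 0 then t else 1) *
          if k' = k ∧ q' = q ∧ r' = r then 1 else 0 := by
      rw [hD, twistVar]
      by_cases h : k' = k ∧ q' = q ∧ r' = r
      · obtain ⟨rfl, rfl, rfl⟩ := h
        by_cases h : q' = 1 ∧ r' = 0 <;> simp [h, t, Derivation.leibniz]
      · have : (some (k', q', r') : TwistVars m) ≠ some (k, q, r) := by simpa using h
        split_ifs <;> simp [t, Derivation.leibniz, MvPolynomial.pderiv_X_of_ne this,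
          MvPolynomial.pderiv_X_of_ne (show (none : TwistVars m) ≠ some (k, q, r) by simp)]
    change (E k q r) _ = _
    simp only [E, Derivation.smul_apply, Matrix.of_apply, this, smul_eq_mul]
    by_cases h : k' = k ∧ q' = q ∧ r' = r
    · obtain ⟨rfl, rfl, rfl⟩ := h
      by_cases h : q' = 1 ∧ r' = 0 <;> simp [h, ht]
    · simp [h]
  · simp [hσ, twistVar, revVars]
  · simp [hσ, twistVar, revVars]
  · simp [hσ, twistVar, revVars, t]
  · simp [hσ, twistVar, revVars, t]
  · obtain ⟨f, g, hg, rfl⟩ := IsFractionRing.div_surjective (A := MvPolynomial (TwistVars m) K) ρ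
    have hg0 := nonZeroDivisors.ne_zero hg
    intro h
    have hinj' := IsFractionRing.injective (MvPolynomial (TwistVars m) K) (TwistField K m)
    have h1 : algebraMap (MvPolynomial (TwistVars m) K) (TwistField K m) g ≠ 0 :=
      fun h0 => hg0 (hinj' (h0.trans (map_zero _).symm))
    have h2 := (map_ne_zero σ).2 h1
    rw [map_div₀, div_mul_div_comm, div_eq_iff (mul_ne_zero h1 h2), hσ, hσ, ← map_mul, ← map_mul,
      ← map_mul] at h
    exact mul_rename_ne hg0 (hinj' h)

lemma exists_linearIndependent_rows {F ι κ : Type*} [Field F] [Finite ι] [Fintype κ]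
    (A : Matrix ι κ F) : ∃ f : Fin A.rank → ι, LinearIndependent F (A.submatrix f id).row := by
  obtain ⟨g, hg, -, hli⟩ := Submodule.exists_fun_fin_finrank_span_eq F (Set.range A.row)
  choose f hf using hg
  have e : A.rank = Module.finrank F (Submodule.span F (Set.range A.row)) :=
    A.rank_eq_finrank_span_row
  refine ⟨fun i => f (i.cast e), ?_⟩
  have : (A.submatrix (fun i => f (i.cast e)) id).row = g ∘ Fin.cast e :=
    funext fun i => hf _
  rw [this]
  exact hli.comp _ (Fin.cast_injective e)

lemma exists_submatrix_det_ne_zero {F ι κ : Type*} [Field F] [Finite ι] [Fintype κ]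
    (A : Matrix ι κ F) :
    ∃ (f : Fin A.rank → ι) (g : Fin A.rank → κ), (A.submatrix f g).det ≠ 0 := by
  obtain ⟨f, hf⟩ := exists_linearIndependent_rows A
  have hr : (A.submatrix f id)ᵀ.rank = A.rank := by
    rw [rank_transpose, hf.rank_matrix, Fintype.card_fin]
  obtain ⟨g, hg⟩ := exists_linearIndependent_rows (A.submatrix f id)ᵀ
  refine ⟨f, g ∘ Fin.cast hr.symm, ?_⟩
  rw [← det_transpose, ← isUnit_iff_ne_zero, ← Matrix.isUnit_iff_isUnit_det,
    ← Matrix.linearIndependent_rows_iff_isUnit]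
  exact hg.comp _ (Fin.cast_injective hr.symm)

lemma le_rank_of_submatrix_det_ne_zero {F ι κ : Type*} [Field F] [Fintype ι] [Fintype κ] {r : ℕ}
    (A : Matrix ι κ F) (f : Fin r → ι) (g : Fin r → κ) (h : (A.submatrix f g).det ≠ 0) :
    r ≤ A.rank := by
  rw [← Fintype.card_fin r, ← rank_of_det_ne_zero h]
  exact rank_submatrix_le A f g

lemma rank_map_le_rank_map_fractionRing {R F ι κ : Type*} [CommRing R] [IsDomain R] [Field F]
    [Fintype ι] [Fintype κ] (A : Matrix ι κ R) (φ : R →+* F) :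
    (A.map φ).rank ≤ (A.map (algebraMap R (FractionRing R))).rank := by
  obtain ⟨f, g, h⟩ := exists_submatrix_det_ne_zero (A.map φ)
  refine le_rank_of_submatrix_det_ne_zero _ f g fun h0 => h ?_
  rw [Matrix.submatrix_map, ← RingHom.mapMatrix_apply, ← RingHom.map_det] at h0 ⊢
  rw [(IsFractionRing.injective R (FractionRing R)) (h0.trans (map_zero _).symm), map_zero]

section LeadingSpace

variable {K L τ : Type*} [Field K] [Field L] [Algebra (MvPolynomial τ K) L]
  (mo : MonomialOrder τ) {n : ℕ}

/-- The leading coefficient vectors, with respect to `mo`, of the polynomial vectors in `S`. -/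
def leadingSpace (S : Submodule L
    (Fin n → L)) : Submodule K (Fin n → K) where
  carrier := {c | ∃ (f : Fin n → MvPolynomial τ K) (d : τ →₀ ℕ),
    (fun i => algebraMap _ L (f i)) ∈ S ∧
    (∀ i, mo.toSyn (mo.degree (f i)) ≤ mo.toSyn d) ∧ ∀ i, (f i).coeff d = c i}
  add_mem' := by
    rintro c c' ⟨f, d, hf, hd, hc⟩ ⟨f', d', hf', hd', hc'⟩
    have hX : ∀ e : τ →₀ ℕ, mo.toSyn (mo.degree (MvPolynomial.monomial e (1 : K))) ≤ mo.toSyn e :=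
      fun e => mo.degree_monomial_le 1
    refine ⟨fun i => MvPolynomial.monomial d' 1 * f i + MvPolynomial.monomial d 1 * f' i, d' + d,
      ?_, fun i => ?_, fun i => ?_⟩
    · convert S.add_mem (S.smul_mem (algebraMap _ _ (MvPolynomial.monomial d' (1 : K))) hf)
        (S.smul_mem (algebraMap _ _ (MvPolynomial.monomial d (1 : K))) hf') using 1
      ext i
      simp [Algebra.smul_def]
    · refine mo.degree_add_le.trans (sup_le (mo.degree_mul_le.trans ?_)
        (mo.degree_mul_le.trans ?_))
      · rw [map_add, map_add]
        exact add_le_add (hX _) (hd i)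
      · rw [map_add, map_add, add_comm (mo.toSyn d')]
        exact add_le_add (hX _) (hd' i)
    · rw [MvPolynomial.coeff_add, mo.coeff_mul_of_add_of_degree_le (hX d') (hd i), add_comm d' d,
        mo.coeff_mul_of_add_of_degree_le (hX d) (hd' i), hc, hc']
      classical
      simp [MvPolynomial.coeff_monomial]
  zero_mem' := ⟨0, 0, by simp only [Pi.zero_apply, map_zero]; exact S.zero_mem, by simp, by simp⟩
  smul_mem' := by
    rintro r c ⟨f, d, hf, hd, hc⟩
    refine ⟨fun i => MvPolynomial.C r * f i, d, ?_, fun i => ?_, fun i => ?_⟩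
    · convert S.smul_mem (algebraMap _ _ (MvPolynomial.C r : MvPolynomial τ K)) hf using 1
      ext i
      simp
    · refine mo.degree_mul_le.trans ?_
      rw [mo.degree_C, zero_add]
      exact hd i
    · simp [hc]

lemma mem_leadingSpace {S : Submodule L (Fin n → L)} {c : Fin n → K} :
    c ∈ leadingSpace mo S ↔ ∃ (f : Fin n → MvPolynomial τ K) (d : τ →₀ ℕ),
      (fun i => algebraMap _ L (f i)) ∈ S ∧
      (∀ i, mo.toSyn (mo.degree (f i)) ≤ mo.toSyn d) ∧ ∀ i, (f i).coeff d = c i := Iff.rfl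

lemma finrank_leadingSpace_le [IsFractionRing (MvPolynomial τ K) L] (S : Submodule L
    (Fin n → L)) :
    Module.finrank K (leadingSpace (K := K) mo S) ≤
      Module.finrank L S := by
  classical
  let B := Module.finBasis K (leadingSpace (K := K) mo S)
  have hB : LinearIndependent K (fun i => (B i : Fin n → K)) :=
    B.linearIndependent.map' (leadingSpace (K := K) mo S).subtype (Submodule.ker_subtype _)
  choose f d hf hd hc using fun j => (mem_leadingSpace mo).1 (B j).2
  let F : Fin (Module.finrank K (leadingSpace (K := K) mo S)) → S := fun j => ⟨_, hf j⟩
  suffices h : LinearIndependent L F by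
    simpa using h.fintype_card_le_finrank
  rw [← LinearIndependent.iff_fractionRing (R := MvPolynomial τ K) (K := L), Fintype.linearIndependent_iff]
  intro g hg
  by_contra! hne
  obtain ⟨j₀, hj₀⟩ := hne
  have hg' : ∀ i, ∑ j, g j * f j i = 0 := by
    intro i
    have := congrFun (congrArg Subtype.val hg) i
    apply IsFractionRing.injective (MvPolynomial τ K) L
    simpa [F, Algebra.smul_def] using this
  obtain ⟨j₁, hj₁, hmax⟩ := Finset.exists_max_image (Finset.univ.filter fun j => g j ≠ 0)
    (fun j => mo.toSyn (mo.degree (g j) + d j)) ⟨j₀, by simpa using hj₀⟩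
  have hcoeff : ∀ j i, (g j * f j i).coeff (mo.degree (g j₁) + d j₁) =
      (if mo.degree (g j) + d j = mo.degree (g j₁) + d j₁ then (g j).coeff (mo.degree (g j))
        else 0) * (B j : Fin n → K) i := by
    intro j i
    by_cases hj : g j = 0
    · simp [hj]
    split_ifs with h
    · rw [← h, mo.coeff_mul_of_add_of_degree_le le_rfl (hd j i), hc]
    · rw [zero_mul]
      refine mo.coeff_eq_zero_of_lt (lt_of_le_of_lt (mo.degree_mul_le.trans ?_)
        (lt_of_le_of_ne (hmax j (by simpa using hj)) fun e => h (mo.toSyn.injective e)))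
      rw [map_add, map_add]
      exact add_le_add_right (hd j i) _
  have hz := Fintype.linearIndependent_iff.1 hB
    (fun j => if mo.degree (g j) + d j = mo.degree (g j₁) + d j₁ then
      (g j).coeff (mo.degree (g j)) else 0) (by
      ext i
      have := congrArg (MvPolynomial.coeff (mo.degree (g j₁) + d j₁)) (hg' i)
      rw [MvPolynomial.coeff_sum, MvPolynomial.coeff_zero] at this
      simpa only [hcoeff, Finset.sum_apply, Pi.smul_apply, smul_eq_mul, Pi.zero_apply] using this) j₁
  rw [if_pos rfl] at hz
  exact mo.coeff_degree_ne_zero_iff.2 (by simpa using hj₁) hz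

variable [Algebra K L] [IsScalarTower K (MvPolynomial τ K) L]

variable {mo} in
lemma smul_add_smul_mem_leadingSpace {S : Submodule L
    (Fin n → L)} {a b : Fin n → K} {p q : MvPolynomial τ K}
    {d : τ →₀ ℕ} (hp : mo.toSyn (mo.degree p) ≤ mo.toSyn d)
    (hq : mo.toSyn (mo.degree q) ≤ mo.toSyn d)
    (h : algebraMap _ L p • (fun i => algebraMap K _ (a i)) +
      algebraMap _ L q • (fun i => algebraMap K _ (b i)) ∈ S) :
    p.coeff d • a + q.coeff d • b ∈ leadingSpace mo S := by
  refine ⟨fun i => MvPolynomial.C (a i) * p + MvPolynomial.C (b i) * q, d, ?_, fun i => ?_,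
    fun i => ?_⟩
  · convert h using 1
    ext i
    simp [IsScalarTower.algebraMap_apply K (MvPolynomial τ K) L,
      Algebra.smul_def, mul_comm]
  · refine mo.degree_add_le.trans (sup_le (mo.degree_mul_le.trans ?_)
        (mo.degree_mul_le.trans ?_)) <;> rwa [mo.degree_C, zero_add]
  · simp only [MvPolynomial.coeff_add, MvPolynomial.coeff_C_mul, Pi.add_apply, Pi.smul_apply,
      smul_eq_mul]
    ring

lemma finrank_inf_line_le_leadingSpace [IsFractionRing (MvPolynomial τ K) L] (S : Submodule L
    (Fin n → L)) {a b : Fin n → K}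
    (h : LinearIndependent K ![a, b])
    (h' : LinearIndependent L
      ![fun i => algebraMap K L (a i),
        fun i => algebraMap K L (b i)]) :
    Module.finrank L
      ↥(S ⊓ line (fun i => algebraMap K L (a i))
        (fun i => algebraMap K L (b i))) ≤
      Module.finrank K ↥(leadingSpace mo S ⊓ line a b) := by
  set T := S ⊓ line (fun i => algebraMap K L (a i))
        (fun i => algebraMap K L (b i)) with hT
  have hle : Module.finrank L T ≤ 2 := by
    rw [← finrank_line h']
    exact Submodule.finrank_mono inf_le_right
  by_cases h2 : Module.finrank L T = 2
  · have hTl : T = line (fun i => algebraMap K L (a i))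
        (fun i => algebraMap K L (b i)) :=
      Submodule.eq_of_le_of_finrank_eq inf_le_right (by rw [h2, finrank_line h'])
    rw [h2, ← finrank_line h]
    refine Submodule.finrank_mono (le_inf ?_ le_rfl)
    have hlS := inf_eq_right.1 hTl
    refine Submodule.span_le.2 ?_
    rintro x (rfl | rfl)
    · have := smul_add_smul_mem_leadingSpace (mo := mo) (S := S) (a := x) (b := b) (p := 1)
        (q := 0) (d := 0) (by simp) (by simp)
        (by simpa using hlS (Submodule.subset_span (by simp)))
      simpa using this
    · have := smul_add_smul_mem_leadingSpace (mo := mo) (S := S) (a := a) (b := x) (p := 0)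
        (q := 1) (d := 0) (by simp) (by simp)
        (by simpa using hlS (Submodule.subset_span (by simp)))
      simpa using this
  by_cases h0 : Module.finrank L T = 0
  · omega
  have h1 : Module.finrank L T = 1 := by omega
  rw [h1, Nat.one_le_iff_ne_zero, Ne, Submodule.finrank_eq_zero]
  obtain ⟨v, ⟨hvS, hvl⟩, hv0⟩ := Submodule.exists_mem_ne_zero_of_ne_bot
    (fun hb => h0 (Submodule.finrank_eq_zero.2 hb))
  obtain ⟨x, y, rfl⟩ := Submodule.mem_span_pair.1 hvl
  classical
  obtain ⟨⟨s, hs⟩, hden⟩ := IsLocalization.exist_integer_multiples_of_finset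
    (nonZeroDivisors (MvPolynomial τ K)) ({x, y} : Finset L)
  obtain ⟨p, hp⟩ := hden x (by simp)
  obtain ⟨q, hq⟩ := hden y (by simp)
  have hs0 : algebraMap (MvPolynomial τ K) L s ≠ 0 :=
    IsFractionRing.to_map_ne_zero_of_mem_nonZeroDivisors hs
  have hmem := S.smul_mem (algebraMap (MvPolynomial τ K) L s) hvS
  simp only [Algebra.smul_def] at hp hq
  rw [smul_add, smul_smul, smul_smul, ← hp, ← hq] at hmem
  have hpq : ∃ d, mo.toSyn (mo.degree p) ≤ mo.toSyn d ∧ mo.toSyn (mo.degree q) ≤ mo.toSyn d ∧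
      (p.coeff d ≠ 0 ∨ q.coeff d ≠ 0) := by
    have hne : p ≠ 0 ∨ q ≠ 0 := by
      by_contra! hcon
      rw [hcon.1, map_zero, eq_comm] at hp
      rw [hcon.2, map_zero, eq_comm] at hq
      apply hv0
      rw [(mul_eq_zero.1 hp).resolve_left hs0, (mul_eq_zero.1 hq).resolve_left hs0]
      simp
    rcases le_total (mo.toSyn (mo.degree p)) (mo.toSyn (mo.degree q)) with hpq | hpq
    · by_cases hq0 : q = 0
      · refine ⟨mo.degree p, le_rfl, ?_,
          Or.inl (mo.coeff_degree_ne_zero_iff.2 (hne.resolve_right (not_not.2 hq0)))⟩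
        simp [hq0]
      · exact ⟨mo.degree q, hpq, le_rfl, Or.inr (mo.coeff_degree_ne_zero_iff.2 hq0)⟩
    · by_cases hp0 : p = 0
      · refine ⟨mo.degree q, ?_, le_rfl,
          Or.inr (mo.coeff_degree_ne_zero_iff.2 (hne.resolve_left (not_not.2 hp0)))⟩
        simp [hp0]
      · exact ⟨mo.degree p, le_rfl, hpq, Or.inl (mo.coeff_degree_ne_zero_iff.2 hp0)⟩
  obtain ⟨d, hpd, hqd, hd⟩ := hpq
  refine Submodule.ne_bot_iff _ |>.2 ⟨p.coeff d • a + q.coeff d • b,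
    ⟨smul_add_smul_mem_leadingSpace hpd hqd hmem, ?_⟩, fun h0 => ?_⟩
  · exact Submodule.add_mem _ (Submodule.smul_mem _ _ (Submodule.subset_span (by simp)))
      (Submodule.smul_mem _ _ (Submodule.subset_span (by simp)))
  · have := LinearIndependent.pair_iff.1 h _ _ h0
    tauto

end LeadingSpace

/-- The blow-up with polynomial entries. -/
def polyBlowup {K : Type*} [Field K] {n m : ℕ} (a b : Fin m → Fin n → K) (d : ℕ) :
    Matrix (Fin d × Fin n) (Fin d × Fin n) (MvPolynomial (Fin m × Fin d × Fin d) K) :=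
  blockMatrix (fun k => Matrix.of fun p q => MvPolynomial.X (k, p, q))
    (fun i j => MvPolynomial.C (a i j)) (fun i j => MvPolynomial.C (b i j))

lemma blockMatrix_map {R S : Type*} [CommRing R] [CommRing S] {n m d : ℕ}
    (X : Fin m → Matrix (Fin d) (Fin d) R) (a b : Fin m → Fin n → R) (φ : R →+* S) :
    (blockMatrix X a b).map φ =
      blockMatrix (fun k => (X k).map φ) (fun i j => φ (a i j)) (fun i j => φ (b i j)) := by
  ext p i
  simp [blockMatrix]

lemma polyBlowup_map {K : Type*} [Field K] {n m : ℕ} (a b : Fin m → Fin n → K) (d : ℕ) :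
    (polyBlowup a b d).map (algebraMap _ (FF K m d)) = blowup a b d := by
  ext p i
  simp [polyBlowup, blockMatrix, blowup, Matrix.sum_apply, wedge, vecMulVec_apply, toFF]

lemma linearIndependent_pair_algebraMap {K L : Type*} [Field K] [Field L] [Algebra K L] {n : ℕ}
    {a b : Fin n → K} (h : LinearIndependent K ![a, b]) :
    LinearIndependent L ![fun i => algebraMap K L (a i), fun i => algebraMap K L (b i)] := by
  have h' := (linearIndependent_algebraMap_comp_iff (S := L)).2 h
  have e : ![fun i => algebraMap K L (a i), fun i => algebraMap K L (b i)] =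
      fun i => algebraMap K L ∘ ![a, b] i := by
    ext i j
    fin_cases i <;> rfl
  rw [e]
  exact h'

lemma sum_finrank_inf_line_mul_le {K L τ : Type*} [Field K] [Field L] [Finite τ]
    [Algebra (MvPolynomial τ K) L] [IsFractionRing (MvPolynomial τ K) L] [Algebra K L]
    [IsScalarTower K (MvPolynomial τ K) L] {n m : ℕ}
    {a b : Fin m → Fin n → K} (hab : ∀ i, LinearIndependent K ![a i, b i]) {y : Fin m → ℝ}
    (hy : IsFracMatching a b y) (S : Submodule L (Fin n → L)) :
    ∑ i, (Module.finrank L ↥(S ⊓ line (fun j => algebraMap K L (a i j))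
      (fun j => algebraMap K L (b i j))) : ℝ) * y i ≤ Module.finrank L S := by
  classical
  let _ : LinearOrder τ := linearOrderOfSTO WellOrderingRel
  let mo : MonomialOrder τ := MonomialOrder.lex
  calc _ ≤ ∑ i, (Module.finrank K ↥(leadingSpace mo S ⊓ line (a i) (b i)) : ℝ) * y i := by
        refine Finset.sum_le_sum fun i _ => mul_le_mul_of_nonneg_right ?_ (hy.1 i)
        exact_mod_cast finrank_inf_line_le_leadingSpace mo S (hab i)
          (linearIndependent_pair_algebraMap (hab i))
    _ ≤ Module.finrank K (leadingSpace (K := K) mo S) := hy.2 _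
    _ ≤ _ := by exact_mod_cast finrank_leadingSpace_le mo S

lemma GenericBlocks.rank_le_rank_blowup {K L : Type*} [Field K] [Field L] [Algebra K L] {n m : ℕ}
    {a b : Fin m → Fin n → K}
    (G : GenericBlocks K (fun i j => algebraMap K L (a i j)) (fun i j => algebraMap K L (b i j))) :
    G.M.rank ≤ (blowup a b 2).rank := by
  let φ : MvPolynomial (Fin m × Fin 2 × Fin 2) K →+* L :=
    MvPolynomial.eval₂Hom (algebraMap K L) fun i => G.X i.1 i.2.1 i.2.2
  have hφ : G.M = (polyBlowup a b 2).map φ := by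
    rw [polyBlowup, blockMatrix_map, GenericBlocks.M]
    congr 1
    · ext k q r
      simp [φ]
    · ext i j
      simp [φ]
    · ext i j
      simp [φ]
  rw [hφ, ← polyBlowup_map]
  exact rank_map_le_rank_map_fractionRing _ φ

lemma GenericBlocks.sum_le_rank_div_four {K L τ : Type*} [Field K] [Field L] [Finite τ]
    [Algebra (MvPolynomial τ K) L] [IsFractionRing (MvPolynomial τ K) L] [Algebra K L]
    [IsScalarTower K (MvPolynomial τ K) L] {n m : ℕ} {a b : Fin m → Fin n → K}
    (G : GenericBlocks K (fun i j => algebraMap K L (a i j)) (fun i j => algebraMap K L (b i j)))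
    (hab : ∀ i, LinearIndependent K ![a i, b i]) {y : Fin m → ℝ} (hy : IsFracMatching a b y) :
    ∑ i, y i ≤ (G.M.rank : ℝ) / 4 := by
  have h1 := sum_finrank_inf_line_mul_le (τ := τ) hab hy G.spread
  have h2 := sum_finrank_inf_line_mul_le (τ := τ) hab hy G.constAnn
  have h3 : (2 : ℝ) * (Module.finrank L G.spread + Module.finrank L G.constAnn) ≤ G.M.rank := by
    exact_mod_cast G.two_mul_finrank_add_le
  have h4 := Finset.sum_le_sum fun i (_ : i ∈ Finset.univ) =>
    mul_le_mul_of_nonneg_right (a := y i)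
      (Nat.cast_le (α := ℝ).2 (G.two_le_finrank_inf_line_add i
        (linearIndependent_pair_algebraMap (hab i)))) (hy.1 i)
  simp only [Nat.cast_add, Nat.cast_ofNat, add_mul, Finset.sum_add_distrib,
    ← Finset.mul_sum] at h4
  linarith

theorem sum_le_rank_blowup_div_four {K : Type*} [Field K] {n m : ℕ} {a b : Fin m → Fin n → K}
    (hab : ∀ i, LinearIndependent K ![a i, b i]) {y : Fin m → ℝ} (hy : IsFracMatching a b y) :
    ∑ i, y i ≤ ((blowup a b 2).rank : ℝ) / 4 := by
  obtain ⟨G⟩ := nonempty_genericBlocks a b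
  refine (G.sum_le_rank_div_four (τ := TwistVars m) hab hy).trans ?_
  gcongr
  exact G.rank_le_rank_blowup

section WeightGE

open MvPolynomial

variable {K σ : Type*} [CommRing K]

/-- The polynomials all of whose monomials have weight at least `N`. -/
def weightGE (K : Type*) [CommRing K] (w : σ → ℕ) (N : ℕ) : Submodule K (MvPolynomial σ K) where
  carrier := {f | ∀ d, f.coeff d ≠ 0 → N ≤ Finsupp.weight w d}
  add_mem' {f g} hf hg d hd := by
    by_cases h : f.coeff d = 0
    · exact hg d fun h' => hd (by rw [coeff_add, h, h', add_zero])
    · exact hf d h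
  zero_mem' d hd := absurd (coeff_zero d) hd
  smul_mem' c f hf d hd := hf d fun h => hd (by rw [coeff_smul, h, smul_zero])

lemma mem_weightGE {w : σ → ℕ} {N : ℕ} {f : MvPolynomial σ K} :
    f ∈ weightGE K w N ↔ ∀ d, f.coeff d ≠ 0 → N ≤ Finsupp.weight w d := Iff.rfl

lemma mul_mem_weightGE {w : σ → ℕ} {M N : ℕ} {f g : MvPolynomial σ K} (hf : f ∈ weightGE K w M)
    (hg : g ∈ weightGE K w N) : f * g ∈ weightGE K w (M + N) := by
  classical
  intro d hd
  rw [coeff_mul] at hd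
  obtain ⟨x, hx, hne⟩ := Finset.exists_ne_zero_of_sum_ne_zero hd
  rw [← Finset.HasAntidiagonal.mem_antidiagonal.1 hx, map_add]
  exact add_le_add (hf _ (left_ne_zero_of_mul hne)) (hg _ (right_ne_zero_of_mul hne))

lemma prod_mem_weightGE {ι : Type*} (s : Finset ι) {w : σ → ℕ} {N : ι → ℕ}
    {f : ι → MvPolynomial σ K} (h : ∀ i ∈ s, f i ∈ weightGE K w (N i)) :
    ∏ i ∈ s, f i ∈ weightGE K w (∑ i ∈ s, N i) := by
  classical
  induction s using Finset.induction_on with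
  | empty => exact fun d _ => Nat.zero_le _
  | insert i s hi ih =>
    rw [Finset.prod_insert hi, Finset.sum_insert hi]
    exact mul_mem_weightGE (h i (Finset.mem_insert_self _ _))
      (ih fun j hj => h j (Finset.mem_insert_of_mem hj))

lemma X_mul_C_mem_weightGE {w : σ → ℕ} {N : ℕ} {s : σ} {c : K} (h : c ≠ 0 → N ≤ w s) :
    (X s * C c : MvPolynomial σ K) ∈ weightGE K w N := by
  classical
  intro d hd
  rw [mul_comm, coeff_C_mul, coeff_X] at hd
  have hs := right_ne_zero_of_mul hd
  rw [ne_eq, ite_eq_right_iff, Classical.not_imp] at hs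
  rw [← hs.1, Finsupp.weight_apply, Finsupp.sum_single_index (zero_smul ℕ (w s)), one_smul]
  exact h (left_ne_zero_of_mul hd)

lemma det_mem_weightGE {ι : Type*} [Fintype ι] [DecidableEq ι] {w : σ → ℕ} {α β : ι → ℕ}
    {M : Matrix ι ι (MvPolynomial σ K)} (h : ∀ i j, M i j ∈ weightGE K w (α i + β j)) :
    M.det ∈ weightGE K w (∑ i, α i + ∑ i, β i) := by
  rw [det_apply]
  refine Submodule.sum_mem _ fun τ _ => ?_
  rw [Units.smul_def, ← Int.cast_smul_eq_zsmul K]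
  refine Submodule.smul_mem _ _ ?_
  rw [← Equiv.sum_comp τ α, ← Finset.sum_add_distrib]
  exact prod_mem_weightGE _ fun i _ => h _ _

lemma isHomogeneous_det {ι : Type*} [Fintype ι] [DecidableEq ι]
    {M : Matrix ι ι (MvPolynomial σ K)} (h : ∀ i j, (M i j).IsHomogeneous 1) :
    M.det.IsHomogeneous (Fintype.card ι) := by
  rw [det_apply]
  refine IsHomogeneous.sum _ _ _ fun τ _ => ?_
  rw [Units.smul_def, ← Int.cast_smul_eq_zsmul K, smul_eq_C_mul]
  have hp := IsHomogeneous.prod Finset.univ _ _ fun i _ => h (τ i) i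
  rw [Finset.sum_const, Finset.card_univ, smul_eq_mul, mul_one] at hp
  exact hp.C_mul _

end WeightGE

section Linear

variable {K : Type*} [Field K]

lemma exists_det_ne_zero_row_mem {r : ℕ} (V : Submodule K (Fin r → K)) :
    ∃ (Q : Matrix (Fin r) (Fin r) K) (s : Finset (Fin r)), Q.det ≠ 0 ∧
      Module.finrank K V = s.card ∧ ∀ i ∈ s, Q i ∈ V := by
  classical
  obtain ⟨W, hW⟩ := V.exists_isCompl
  let B := ((Module.finBasis K V).prod (Module.finBasis K W)).map
    (Submodule.prodEquivOfIsCompl V W hW)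
  let e := B.indexEquiv (Pi.basisFun K (Fin r))
  refine ⟨of fun i => B (e.symm i), Finset.univ.map (Function.Embedding.inl.trans e.toEmbedding),
    ?_, by simp, ?_⟩
  · rw [← isUnit_iff_ne_zero, ← Matrix.isUnit_iff_isUnit_det,
      ← Matrix.linearIndependent_rows_iff_isUnit]
    exact B.linearIndependent.comp _ e.symm.injective
  · intro i hi
    obtain ⟨j, -, rfl⟩ := Finset.mem_map.1 hi
    have hj : e.symm ((Function.Embedding.inl.trans e.toEmbedding) j) = Sum.inl j :=
      e.symm_apply_apply _
    change B (e.symm ((Function.Embedding.inl.trans e.toEmbedding) j)) ∈ V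
    rw [hj]
    simp [B]

lemma finrank_add_le_finrank_comap_add {E F : Type*} [AddCommGroup E] [Module K E]
    [AddCommGroup F] [Module K F] [FiniteDimensional K E] [FiniteDimensional K F]
    (T : E →ₗ[K] F) (W : Submodule K F) :
    Module.finrank K E + Module.finrank K W ≤
      Module.finrank K (W.comap T) + Module.finrank K F := by
  have h := LinearMap.finrank_range_add_finrank_ker (W.mkQ ∘ₗ T)
  rw [LinearMap.ker_comp, Submodule.ker_mkQ] at h
  have h1 := Submodule.finrank_le (LinearMap.range (W.mkQ ∘ₗ T))
  have h2 := W.finrank_quotient_add_finrank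
  omega

lemma add_le_two_sub_finrank_inf_line {n : ℕ} {a b : Fin n → K} (S : Submodule K (Fin n → K))
    {P Q : Prop} [Decidable P] [Decidable Q] {x x' : Fin n → K}
    (hx : P → x ∈ dotPerp S) (hx' : Q → x' ∈ dotPerp S)
    (h : (a ⬝ᵥ x) * (b ⬝ᵥ x') - (b ⬝ᵥ x) * (a ⬝ᵥ x') ≠ 0) :
    (if P then 1 else 0) + (if Q then 1 else 0) ≤ 2 - Module.finrank K ↥(S ⊓ line a b) := by
  have hab : LinearIndependent K ![a, b] := by
    rw [LinearIndependent.pair_iff]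
    intro s t hst
    have h1 := congrArg (· ⬝ᵥ x) hst
    have h2 := congrArg (· ⬝ᵥ x') hst
    simp only [add_dotProduct, smul_dotProduct, zero_dotProduct, smul_eq_mul] at h1 h2
    constructor
    · refine (mul_eq_zero.1 (?_ : s * _ = 0)).resolve_right h
      linear_combination (b ⬝ᵥ x') * h1 - (b ⬝ᵥ x) * h2
    · refine (mul_eq_zero.1 (?_ : t * _ = 0)).resolve_right h
      linear_combination (a ⬝ᵥ x) * h2 - (a ⬝ᵥ x') * h1
  have h2 := finrank_line hab
  have hle := Submodule.finrank_mono (inf_le_right : S ⊓ line a b ≤ line a b)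
  have hone : P ∨ Q → Module.finrank K ↥(S ⊓ line a b) ≤ 1 := by
    intro hPQ
    by_contra! hcon
    have hl : line a b ≤ S := inf_eq_right.1
      (Submodule.eq_of_le_of_finrank_le inf_le_right (by omega))
    have ha : a ∈ S := hl (Submodule.subset_span (by simp))
    have hb : b ∈ S := hl (Submodule.subset_span (by simp))
    refine h ?_
    rcases hPQ with hP | hQ
    · rw [hx hP a ha, hx hP b hb]; ring
    · rw [hx' hQ a ha, hx' hQ b hb]; ring
  have htwo : P → Q → Module.finrank K ↥(S ⊓ line a b) = 0 := by
    intro hP hQ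
    rw [Submodule.finrank_eq_zero, eq_bot_iff]
    rintro z ⟨hzS, hz⟩
    obtain ⟨s, t, rfl⟩ := Submodule.mem_span_pair.1 hz
    have h1 := hx hP _ hzS
    have h2 := hx' hQ _ hzS
    simp only [add_dotProduct, smul_dotProduct, smul_eq_mul] at h1 h2
    have hs : s = 0 := by
      refine (mul_eq_zero.1 (?_ : s * _ = 0)).resolve_right h
      linear_combination (b ⬝ᵥ x') * h1 - (b ⬝ᵥ x) * h2
    have ht : t = 0 := by
      refine (mul_eq_zero.1 (?_ : t * _ = 0)).resolve_right h
      linear_combination (a ⬝ᵥ x) * h2 - (a ⬝ᵥ x') * h1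
    simp [hs, ht]
  split_ifs with hP hQ hQ
  · simp [htwo hP hQ]
  · have := hone (.inl hP); omega
  · have := hone (.inr hQ); omega
  · omega

end Linear

lemma mul_submatrix_mul_transpose {R ι κ : Type*} [CommRing R] [Fintype ι] [DecidableEq ι]
    [Fintype κ] (G : Matrix ι ι R) (f g : κ → ι) (Q Q' : Matrix κ κ R) :
    Q * G.submatrix f g * Q'ᵀ = Q * (1 : Matrix ι ι R).submatrix f id * G *
      (Q' * (1 : Matrix ι ι R).submatrix g id)ᵀ := by
  have h : G.submatrix f g =
      (1 : Matrix ι ι R).submatrix f id * G * ((1 : Matrix ι ι R).submatrix g id)ᵀ := by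
    ext i j
    simp [mul_apply, one_apply]
  rw [h, transpose_mul]
  simp only [Matrix.mul_assoc]

section Attain

open MvPolynomial

variable {K : Type*} [Field K] {n m : ℕ} (a b : Fin m → Fin n → K)

lemma C_dotProduct_polyBlowup_mulVec {d : ℕ} (u u' : Fin d × Fin n → K) :
    (fun i => C (u i)) ⬝ᵥ (polyBlowup a b d *ᵥ fun i => C (u' i)) =
      ∑ k, ∑ p, ∑ q, X (k, p, q) *
        C ((a k ⬝ᵥ fun j => u (p, j)) * (b k ⬝ᵥ fun j => u' (q, j)) -
          (b k ⬝ᵥ fun j => u (p, j)) * (a k ⬝ᵥ fun j => u' (q, j))) := by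
  have hC : ∀ x y : Fin n → K, ((fun j => C (x j)) ⬝ᵥ fun j => C (y j)) =
      (C (x ⬝ᵥ y) : MvPolynomial (Fin m × Fin d × Fin d) K) := fun x y => by
    simp [dotProduct]
  rw [dotProduct, Fintype.sum_prod_type]
  simp only [polyBlowup, blockMatrix_mulVec, Finset.mul_sum, of_apply, hC]
  rw [Finset.sum_congr rfl fun _ _ => Finset.sum_comm, Finset.sum_comm]
  refine Finset.sum_congr rfl fun k _ => Finset.sum_congr rfl fun p _ => ?_
  rw [Finset.sum_comm]
  refine Finset.sum_congr rfl fun q _ => ?_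
  rw [map_sub, map_mul, map_mul, ← hC (a k) fun j => u (p, j), ← hC (b k) fun j => u (p, j)]
  generalize (C (b k ⬝ᵥ fun j => u' (q, j)) : MvPolynomial _ K) = β,
    (C (a k ⬝ᵥ fun j => u' (q, j)) : MvPolynomial _ K) = α
  simp only [dotProduct, Finset.sum_mul, ← Finset.sum_sub_distrib, Finset.mul_sum]
  exact Finset.sum_congr rfl fun j _ => by ring

lemma le_weight_of_coeff_det_ne_zero {r : ℕ} {f g : Fin r → Fin 2 × Fin n}
    {μ : Fin m × Fin 2 × Fin 2 →₀ ℕ}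
    (hμ : (((polyBlowup a b 2).submatrix f g).det).coeff μ ≠ 0) (S : Submodule K (Fin n → K)) :
    2 * r ≤ Finsupp.weight (fun s : Fin m × Fin 2 × Fin 2 =>
      2 - Module.finrank K ↥(S ⊓ line (a s.1) (b s.1))) μ + 4 * Module.finrank K S := by
  let P (f : Fin r → Fin 2 × Fin n) : Matrix (Fin r) (Fin 2 × Fin n) K :=
    (1 : Matrix _ _ K).submatrix f id
  let V (f : Fin r → Fin 2 × Fin n) : Submodule K (Fin r → K) :=
    (blocks (Fin 2) (dotPerp S)).comap (P f).vecMulLinear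
  have hV : ∀ f, r ≤ Module.finrank K (V f) + 2 * Module.finrank K S := by
    intro f
    have h1 := finrank_add_le_finrank_comap_add (P f).vecMulLinear (blocks (Fin 2) (dotPerp S))
    have h2 := finrank_dotPerp S
    rw [finrank_blocks] at h1
    simp only [Module.finrank_pi, Fintype.card_prod, Fintype.card_fin] at h1 h2
    change r ≤ Module.finrank K ↥((blocks (Fin 2) (dotPerp S)).comap (P f).vecMulLinear) + _
    omega
  obtain ⟨Q, s, hQ, hs, hQs⟩ := exists_det_ne_zero_row_mem (V f)
  obtain ⟨Q', s', hQ', hs', hQs'⟩ := exists_det_ne_zero_row_mem (V g)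
  let w : Fin m × Fin 2 × Fin 2 → ℕ := fun s => 2 - Module.finrank K ↥(S ⊓ line (a s.1) (b s.1))
  let G := polyBlowup a b 2
  let c : Matrix (Fin r) (Fin r) K →
    Matrix (Fin r) (Fin r) (MvPolynomial (Fin m × Fin 2 × Fin 2) K) := fun Q => Q.map C
  have hprod : ∀ (Q : Matrix (Fin r) (Fin r) K) (f : Fin r → Fin 2 × Fin n),
      (Q * P f).map C = c Q *
        (1 : Matrix (Fin 2 × Fin n) (Fin 2 × Fin n)
          (MvPolynomial (Fin m × Fin 2 × Fin 2) K)).submatrix f id := by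
    intro Q f
    rw [Matrix.map_mul, ← submatrix_map, Matrix.map_one _ (map_zero C) (map_one C)]
  have hdet : (c Q * G.submatrix f g * (c Q')ᵀ).det ∈
      weightGE K w (∑ i, (if i ∈ s then 1 else 0) + ∑ i, if i ∈ s' then 1 else 0) := by
    refine det_mem_weightGE fun i j => ?_
    have hentry : (c Q * G.submatrix f g * (c Q')ᵀ) i j =
        (fun l => C ((Q * P f) i l)) ⬝ᵥ (G *ᵥ fun l => C ((Q' * P g) j l)) := by
      rw [mul_submatrix_mul_transpose, ← hprod, ← hprod, Matrix.mul_assoc]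
      rfl
    rw [hentry, C_dotProduct_polyBlowup_mulVec]
    refine Submodule.sum_mem _ fun k _ => Submodule.sum_mem _ fun p _ =>
      Submodule.sum_mem _ fun q _ => X_mul_C_mem_weightGE fun h => ?_
    exact add_le_two_sub_finrank_inf_line S (fun hi => hQs i hi p) (fun hj => hQs' j hj q) h
  have hC : ∀ Q : Matrix (Fin r) (Fin r) K, (c Q).det =
      (C Q.det : MvPolynomial (Fin m × Fin 2 × Fin 2) K) := fun Q =>
    (RingHom.map_det C Q).symm
  rw [det_mul, det_mul, det_transpose, hC, hC] at hdet
  have := mem_weightGE.1 hdet μ (by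
    rw [mul_comm, coeff_C_mul, coeff_C_mul]
    exact mul_ne_zero hQ' (mul_ne_zero hQ hμ))
  simp only [Finset.sum_ite_mem, Finset.univ_inter, Finset.sum_const, smul_eq_mul, mul_one] at this
  have h1 := hV f
  have h2 := hV g
  change _ ≤ Finsupp.weight w μ + _
  omega

theorem exists_isFracMatching (hab : ∀ i, LinearIndependent K ![a i, b i]) :
    ∃ y, IsFracMatching a b y ∧ ∑ i, y i = ((blowup a b 2).rank : ℝ) / 4 := by
  obtain ⟨f, g, hdet⟩ := exists_submatrix_det_ne_zero (blowup a b 2)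
  generalize (blowup a b 2).rank = r at f g hdet ⊢
  have hdet' : ((polyBlowup a b 2).submatrix f g).det ≠ 0 := by
    intro h
    refine hdet ?_
    rw [← polyBlowup_map, submatrix_map, ← RingHom.mapMatrix_apply, ← RingHom.map_det, h, map_zero]
  obtain ⟨μ, hμ⟩ := MvPolynomial.exists_coeff_ne_zero hdet'
  let deg (k : Fin m) : ℕ := ∑ p, ∑ q, μ (k, p, q)
  have hdeg : ∑ k, deg k = r := by
    have hh : (((polyBlowup a b 2).submatrix f g).det).IsHomogeneous r := by
      simpa using isHomogeneous_det (M := (polyBlowup a b 2).submatrix f g) fun i j => by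
        simp only [submatrix_apply, polyBlowup, blockMatrix, of_apply]
        refine IsHomogeneous.sum _ _ _ fun k _ => ?_
        rw [← C_mul, ← C_mul, ← C_sub, mul_comm]
        exact (isHomogeneous_X K _).C_mul _
    have := hh hμ
    rw [Finsupp.weight_apply, Finsupp.sum_fintype _ _ (by simp)] at this
    simpa [deg, Fintype.sum_prod_type] using this
  refine ⟨fun k => (deg k : ℝ) / 4, ⟨fun k => by positivity, fun S => ?_⟩, ?_⟩
  · have h := le_weight_of_coeff_det_ne_zero a b hμ S
    rw [Finsupp.weight_apply, Finsupp.sum_fintype _ _ (by simp)] at h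
    have h1 : ∀ k, (Module.finrank K ↥(S ⊓ line (a k) (b k)) : ℝ) * deg k +
        ((2 - Module.finrank K ↥(S ⊓ line (a k) (b k)) : ℕ) : ℝ) * deg k = 2 * deg k := by
      intro k
      have h2 : Module.finrank K ↥(S ⊓ line (a k) (b k)) ≤ 2 :=
        finrank_line (hab k) ▸ Submodule.finrank_mono inf_le_right
      rw [Nat.cast_sub h2]
      push_cast
      ring
    have h3 := Finset.sum_congr rfl fun k (_ : k ∈ Finset.univ) => h1 k
    rw [Finset.sum_add_distrib, ← Finset.mul_sum, ← Nat.cast_sum, hdeg] at h3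
    have h4 : (2 : ℝ) * r ≤ ∑ k, ((2 - Module.finrank K ↥(S ⊓ line (a k) (b k)) : ℕ) : ℝ) * deg k +
        4 * Module.finrank K S := by
      have e : ∑ s : Fin m × Fin 2 × Fin 2,
          μ s • (2 - Module.finrank K ↥(S ⊓ line (a s.1) (b s.1))) =
          ∑ k, (2 - Module.finrank K ↥(S ⊓ line (a k) (b k))) * deg k := by
        rw [Fintype.sum_prod_type]
        refine Finset.sum_congr rfl fun k _ => ?_
        rw [mul_comm]
        simp only [deg, Fintype.sum_prod_type, Finset.sum_mul, smul_eq_mul]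
      rw [e] at h
      exact_mod_cast h
    simp only [mul_div_assoc', ← Finset.sum_div]
    linarith
  · rw [← Finset.sum_div, ← Nat.cast_sum, hdeg]

end Attain

/-- The second-order blow-up suffices to attain the non-commutative rank:
`max_{y ∈ P} |y| = (1/4) · rank A^{(2)}`. -/
theorem max_fracMatching_eq_quarter_rank_blowup_two
    {K : Type*} [Field K] {n m : ℕ} (hn : 0 < n) (hm : 0 < m)
    (a b : Fin m → Fin n → K) (hab : ∀ i, LinearIndependent K ![a i, b i]) :
    sSup {r : ℝ | ∃ y : Fin m → ℝ, IsFracMatching a b y ∧ r = ∑ i, y i} =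
      ((blowup a b 2).rank : ℝ) / 4 := by
  refine IsGreatest.csSup_eq ⟨?_, ?_⟩
  · obtain ⟨y, hy, h⟩ := exists_isFracMatching a b hab
    exact ⟨y, hy, h.symm⟩
  · rintro _ ⟨y, hy, rfl⟩
    exact sum_le_rank_blowup_div_four hab hy
end
end

section
/- Let G be a finite loopless (simple) graph with vertex set {v_1,…,v_n} and edge set E, and let T_G be its Tutte matrix over a field K. Then for every integer d ≥ n−1, the rank of the d-th order blow-up T_G^{(d)} equals 2d times the maximum cardinality of a fractional matching of G. (Equivalently, the non-commutative rank of the Tutte matrix of a loopless graph is twice the maximum cardinality of a fractional matching.) -/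
open Matrix

noncomputable section

/-- The rational function field generated over `K` by the entries of the `d × d`
indeterminate matrices `X_e`. -/
abbrev FFG (K : Type*) [Field K] (n d : ℕ) : Type _ :=
  FractionRing (MvPolynomial ((Fin n × Fin n) × Fin d × Fin d) K)

/-- The `d`-th order blow-up `T_G^{(d)} = ∑_{e = {vᵢ, vⱼ}, i < j} X_e ⊗ (eᵢ ∧ eⱼ)` of the
Tutte matrix of `G`. -/
def tutteBlowup {K : Type*} [Field K] {n : ℕ} (G : SimpleGraph (Fin n))
    [DecidableRel G.Adj] (d : ℕ) :
    Matrix (Fin d × Fin n) (Fin d × Fin n) (FFG K n d) :=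
  ∑ ij : Fin n × Fin n,
    if ij.1 < ij.2 ∧ G.Adj ij.1 ij.2 then
      kroneckerMap (· * ·)
        (Matrix.of fun p q : Fin d =>
          algebraMap (MvPolynomial ((Fin n × Fin n) × Fin d × Fin d) K) (FFG K n d)
            (MvPolynomial.X (ij, p, q)))
        ((wedge (Pi.single ij.1 (1 : K)) (Pi.single ij.2 (1 : K))).map
          ((algebraMap (MvPolynomial ((Fin n × Fin n) × Fin d × Fin d) K)
            (FFG K n d)).comp MvPolynomial.C))
    else 0

/-- `y : E → ℝ` is a fractional matching of `G`: `y ≥ 0` and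
`∑_{e ∋ v} y_e ≤ 1` for every vertex `v`. -/
def IsFracGraphMatching {n : ℕ} (G : SimpleGraph (Fin n)) [DecidableRel G.Adj]
    (y : G.edgeSet → ℝ) : Prop :=
  (∀ e, 0 ≤ y e) ∧
    ∀ v : Fin n, ∑ e : G.edgeSet, (if v ∈ (e : Sym2 (Fin n)) then y e else 0) ≤ 1

theorem even_seq_eq_zero {α : Type*} [Zero α] {x : ℕ → α} {k : ℕ} (hk : Even k) (hk2 : 2 ≤ k)
    (h2 : x 2 = 0) (hper : x k = x 0) (hlast : x (k - 1) = 0)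
    (hstep : ∀ i, 1 ≤ i → i + 1 < k → x (i + 2) = x i) : ∀ i < k, x i = 0 := by
  obtain ⟨m, rfl⟩ := hk
  have he : ∀ j, 2 * j + 2 ≤ m + m → x (2 * j + 2) = 0 := by
    intro j
    induction j with
    | zero => intro _; exact h2
    | succ j ih => intro h; rw [← ih (by omega)]; exact hstep (2 * j + 2) (by omega) (by omega)
  have ho : ∀ j, 2 * j + 1 ≤ m + m → x (m + m - (2 * j + 1)) = 0 := by
    intro j
    induction j with
    | zero => intro _; exact hlast
    | succ j ih =>
      intro h
      rw [← ih (by omega), ← hstep _ (by omega) (by omega)]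
      congr 1; omega
  intro i hi
  rcases Nat.even_or_odd' i with ⟨j, rfl | rfl⟩
  · rcases j with _ | j
    · rw [mul_zero, ← hper]
      convert he (m - 1) (by omega) using 2
      omega
    · exact he j (by omega)
  · convert ho (m - 1 - j) (by omega) using 2
    omega

theorem odd_seq_eq {α : Type*} {x : ℕ → α} {k : ℕ} (hk : Odd k) (hk3 : 3 ≤ k)
    (hper : x k = x 0)
    (hstep : ∀ i, 2 ≤ i → i + 1 < k → x (i + 2) = x i) :
    x 0 = x 3 ∧ x (k - 1) = x 2 ∧ ∀ i, 2 ≤ i → i < k → x i = x 2 ∨ x i = x 3 := by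
  have h : ∀ i, 2 ≤ i → i ≤ k → (Even i → x i = x 2) ∧ (Odd i → x i = x 3) := by
    intro i
    induction i using Nat.strong_induction_on with
    | _ i ih =>
      intro hi hik
      rcases Nat.lt_or_ge i 4 with h4 | h4
      · obtain rfl | rfl : i = 2 ∨ i = 3 := by omega
        · exact ⟨fun _ => rfl, fun h => absurd h (by decide)⟩
        · exact ⟨fun h => absurd h (by decide), fun _ => rfl⟩
      · obtain ⟨l, rfl⟩ := Nat.exists_eq_add_of_le' (show 2 ≤ i by omega)
        have := ih l (by omega) (by omega) (by omega)
        rw [hstep l (by omega) (by omega)]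
        simpa [Nat.even_add, Nat.odd_add] using this
  refine ⟨hper ▸ (h k (by omega) le_rfl).2 hk, (h (k - 1) (by omega) (by omega)).1 ?_, ?_⟩
  · exact Nat.Odd.sub_odd hk odd_one
  · intro i hi hik
    exact (Nat.even_or_odd i).imp (h i hi hik.le).1 (h i hi hik.le).2

theorem exists_arc_weights {V F ι : Type*} [Fintype V] [Field F] [Fintype ι] [DecidableEq ι]
    (σ : Equiv.Perm V) (S : Set V) (hfix : ∀ v ∈ S, σ v ≠ v)
    (B D : Matrix ι ι F)
    (hBD : 3 ≤ Fintype.card V → ∀ x, B *ᵥ (D *ᵥ x) = D *ᵥ (B *ᵥ x) → x = 0) :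
    ∃ A : V → Matrix ι ι F, (∀ v ∉ S, A v = 0) ∧ (∀ v ∈ S, σ (σ v) = v → A v = 1) ∧
      ∀ u : V → ι → F, (∀ v ∉ S, u (σ v) = 0) →
        (∀ v ∈ S, σ (σ v) = v → u (σ v) = 0) →
        (∀ v ∈ S, σ (σ v) ≠ v → A v *ᵥ u (σ v) = A (σ.symm v) *ᵥ u (σ.symm v)) → u = 0 := by
  classical
  let full : V → Prop := fun v => ∀ w, σ.SameCycle v w → w ∈ S
  obtain ⟨c, hc, hcc⟩ : ∃ c : V → V, (∀ v, σ.SameCycle (c v) v) ∧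
      ∀ v w, σ.SameCycle v w → c v = c w := by
    let s := Equiv.Perm.SameCycle.setoid σ
    exact ⟨fun v => (Quotient.mk s v).out, fun v => Quotient.mk_out (s := s) v,
      fun v w h => congrArg Quotient.out (Quotient.sound (s := s) h)⟩
  let A : V → Matrix ι ι F := fun v =>
    if v ∉ S then 0 else if ¬ full v then 1 else if σ (σ v) = v then 1 else
    if Even (Function.minimalPeriod σ (c v)) then (if v = c v then 0 else 1)
    else if v = c v then D else if v = σ (c v) then B else 1
  refine ⟨A, fun v hv => by simp [A, hv], fun v hv h => by simp [A, hv, h], ?_⟩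
  intro u hu h2 hrow
  suffices h : ∀ v, u (σ v) = 0 by
    funext v; simpa using h (σ.symm v)
  by_cases hne : ∃ v, ¬ full v ∧ u (σ v) ≠ 0
  · exfalso
    have key : ∀ j : ℕ, ∀ v, ¬ full v → (σ.symm ^ j : Equiv.Perm V) v ∉ S → u (σ v) = 0 := by
      intro j
      induction j using Nat.strong_induction_on with
      | _ j ih =>
        intro v hv hj
        by_cases hvS : v ∈ S
        swap
        · exact hu v hvS
        by_cases hv2 : σ (σ v) = v
        · exact h2 v hvS hv2
        have hA : A v = 1 := by simp [A, hvS, hv]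
        have e := hrow v hvS hv2
        rw [hA, one_mulVec] at e
        rw [e]
        have hs : σ.SameCycle (σ.symm v) v := by
          simpa using (Equiv.Perm.sameCycle_apply_right (f := σ) (x := σ.symm v)).2
            (Equiv.Perm.SameCycle.refl σ (σ.symm v))
        have hs2 : σ.SameCycle (σ.symm (σ.symm v)) (σ.symm v) := by
          simpa using (Equiv.Perm.sameCycle_apply_right (f := σ) (x := σ.symm (σ.symm v))).2
            (Equiv.Perm.SameCycle.refl σ (σ.symm (σ.symm v)))
        have hfull : ∀ {a b}, σ.SameCycle a b → ¬ full b → ¬ full a :=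
          fun hab hb ha => hb fun w hw => ha w (hab.trans hw)
        by_cases hv' : σ.symm v ∈ S
        swap
        · simp [A, hv']
        have hA' : A (σ.symm v) = 1 := by simp [A, hv', hfull hs hv]
        rw [hA', one_mulVec]
        rcases j with _ | _ | j
        · exact absurd hvS (by simpa using hj)
        · exact absurd hv' (by simpa using hj)
        · have := ih j (by omega) (σ.symm (σ.symm v)) (hfull (hs2.trans hs) hv)
            (by simpa [pow_succ] using hj)
          simpa using this
    obtain ⟨v, hv, hne⟩ := hne
    have hv' := hv
    simp only [full, not_forall] at hv'
    obtain ⟨w, hw, hwS⟩ := hv'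
    obtain ⟨j, hj⟩ := (Equiv.Perm.sameCycle_inv.2 hw).exists_nat_pow_eq
    exact hne (key j v hv (by change (σ⁻¹ ^ j) v ∉ S; rwa [hj]))
  push Not at hne
  intro v
  by_cases hv : full v
  swap
  · exact hne v hv
  set b := c v with hb
  have hfb : full b := fun w hw => hv w ((hc v).symm.trans hw)
  set k := Function.minimalPeriod σ b with hk
  have hiter : ∀ i : ℕ, σ.SameCycle b (σ^[i] b) := fun i =>
    ⟨i, by simp [← Equiv.Perm.iterate_eq_pow]⟩
  have hS : ∀ i : ℕ, σ^[i] b ∈ S := fun i => hfb _ (hiter i)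
  have hperk : σ^[k] b = b := Function.isPeriodicPt_minimalPeriod σ b
  have hk0 : 0 < k := Function.minimalPeriod_pos_of_mem_periodicPts
    (σ.injective.mem_periodicPts b)
  have hcomm : ∀ i : ℕ, σ (σ (σ^[i] b)) = σ^[i] (σ (σ b)) := fun i => by
    rw [← Function.iterate_succ_apply' σ, ← Function.iterate_succ_apply' σ]; rfl
  suffices hall : ∀ i < k, u (σ^[i] b) = 0 by
    obtain ⟨j, hj⟩ := ((hc v).trans (Equiv.Perm.sameCycle_apply_right.2
      (Equiv.Perm.SameCycle.refl σ v))).exists_nat_pow_eq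
    rw [← Equiv.Perm.iterate_eq_pow, ← hb, ← Function.iterate_mod_minimalPeriod_eq] at hj
    rw [← hj]
    exact hall _ (Nat.mod_lt _ hk0)
  by_cases hk2 : k ≤ 2
  · have h22 : σ (σ b) = b := by
      have h1 : k ≠ 1 := fun h => by
        rw [h] at hperk; exact hfix b (hS 0) hperk
      have : k = 2 := by omega
      rw [this] at hperk; exact hperk
    intro i _
    have := h2 (σ (σ^[i] b)) (by
      simpa [Function.iterate_succ_apply', -Function.iterate_succ] using hS (i + 1))
    have hb2 : σ (σ (σ^[i] b)) = σ^[i] b := by rw [hcomm, h22]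
    rw [hb2] at this
    exact this rfl
  push Not at hk2
  have hinj : ∀ i j, i < k → j < k → (σ^[i] b = σ^[j] b ↔ i = j) := fun i j hi hj =>
    Function.iterate_eq_iterate_iff_of_lt_minimalPeriod hi hj
  have hnsw : ∀ i, σ (σ (σ^[i] b)) ≠ σ^[i] b := by
    intro i h
    rw [hcomm] at h
    have := σ.injective.iterate i h
    have := (hinj 2 0 (by omega) (by omega)).1 this
    omega
  have hcb : ∀ i : ℕ, c (σ^[i] b) = b := fun i =>
    (hcc _ _ ((hc v).symm.trans (hiter i))).symm
  have hfi : ∀ i : ℕ, full (σ^[i] b) := fun i w hw => hfb w ((hiter i).trans hw)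
  have hAi : ∀ i, A (σ^[i] b) = if Even k then (if σ^[i] b = b then 0 else 1)
    else if σ^[i] b = b then D else if σ^[i] b = σ b then B else 1 := by
    intro i
    simp only [A, hcb, ← hk, hS i, hfi i, hnsw i, not_true, if_false]
  have hAi' : ∀ i, i < k → A (σ^[i] b) = if Even k then (if i = 0 then 0 else 1)
    else if i = 0 then D else if i = 1 then B else 1 := by
    intro i hi
    rw [hAi]
    have e0 := hinj i 0 hi (by omega)
    have e1 := hinj i 1 hi (by omega)
    simp only [Function.iterate_zero, id, Function.iterate_one] at e0 e1
    simp only [e0, e1]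
  have hr : ∀ i, A (σ^[i + 1] b) *ᵥ u (σ^[i + 2] b) = A (σ^[i] b) *ᵥ u (σ^[i] b) := by
    intro i
    have := hrow (σ^[i + 1] b) (hS _) (hnsw _)
    simpa [Function.iterate_succ_apply', -Function.iterate_succ] using this
  have hstep2 : ∀ i, 2 ≤ i → i + 1 < k → u (σ^[i + 2] b) = u (σ^[i] b) := by
    intro i hi hik
    have := hr i
    rw [hAi' _ hik, hAi' i (by omega)] at this
    simpa [show i ≠ 0 by omega, show i ≠ 1 by omega] using this
  have hlast := hr (k - 1)
  rw [show k - 1 + 2 = k + 1 by omega, show k - 1 + 1 = k by omega, hperk,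
    Function.iterate_succ_apply' σ k, hperk, hAi' (k - 1) (by omega)] at hlast
  have hAb := hAi' 0 hk0
  simp only [Function.iterate_zero, id] at hAb
  rw [hAb] at hlast
  have hr0 := hr 0
  have hr1 := hr 1
  rw [hAi' _ (by omega), hAi' _ (by omega)] at hr0 hr1
  by_cases hev : Even k
  · refine even_seq_eq_zero (x := fun i => u (σ^[i] b)) hev (by omega) ?_ ?_ ?_ ?_
    · simpa [hev] using hr0
    · simp [hperk]
    · simpa [hev, show k - 1 ≠ 0 by omega] using hlast.symm
    · intro i hi hik
      rcases hi.eq_or_lt with rfl | hi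
      · simpa [hev] using hr1
      · exact hstep2 i hi hik
  · obtain ⟨h03, hk12, hall⟩ := odd_seq_eq (x := fun i => u (σ^[i] b)) (Nat.not_even_iff_odd.1 hev)
      (by omega) (by simp [hperk]) hstep2
    simp only [hev, if_false, if_true, one_ne_zero, zero_add, show k - 1 ≠ 0 by omega,
      show k - 1 ≠ 1 by omega, show 1 + 1 ≠ 0 by omega, show 1 + 1 ≠ 1 by omega, one_mulVec]
      at hr0 hr1 hlast
    have hcard : 3 ≤ Fintype.card V := by
      refine le_trans (show 3 ≤ k from hk2) ?_
      simpa using Fintype.card_le_of_injective (fun i : Fin k => σ^[i] b)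
        fun i j h => Fin.ext ((hinj i j i.2 j.2).1 h)
    have hx1 : u (σ^[1] b) = 0 := by
      apply hBD hcard
      change D *ᵥ u (σ^[1] b) = _ at hlast
      rw [hlast, hk12, hr0, h03]
      exact congrArg _ hr1
    have hx2 : u (σ^[2] b) = 0 := by
      rw [← hk12, ← hlast]; change D *ᵥ u (σ^[1] b) = _; rw [hx1, mulVec_zero]
    have hx3 : u (σ^[3] b) = 0 := by
      refine hr1.trans ?_; rw [hx1, mulVec_zero]
    intro i hi
    rcases i with _ | _ | i
    · exact h03.trans hx3
    · exact hx1
    · rcases hall (i + 2) (by omega) hi with h | h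
      · exact h.trans hx2
      · exact h.trans hx3

theorem exists_commutator_injective {F : Type*} [Field F] [Infinite F] (d : ℕ) :
    ∃ B D : Matrix (Fin d) (Fin d) F, 2 ≤ d →
      ∀ x, B *ᵥ (D *ᵥ x) = D *ᵥ (B *ᵥ x) → x = 0 := by
  rcases d with _ | d
  · exact ⟨0, 0, by simp⟩
  let a : Fin (d + 1) → F := fun i => Infinite.natEmbedding F i
  refine ⟨Matrix.of fun i => Pi.single (i + 1) 1, diagonal a, fun hd x hx => ?_⟩
  funext i
  have h := congrFun hx (i - 1)
  have hB : ∀ (y : Fin (d + 1) → F) i,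
      ((Matrix.of fun i => Pi.single (i + 1) (1 : F)) *ᵥ y) i = y (i + 1) :=
    fun y i => by simp [mulVec]
  simp only [hB, mulVec_diagonal, sub_add_cancel] at h
  have hne : a i ≠ a (i - 1) := by
    intro he
    have he' := Fin.ext ((Infinite.natEmbedding F).injective he)
    have : (1 : Fin (d + 1)) = 0 := by simpa using he'.symm
    have := congrArg Fin.val this
    have h1 : 1 % (d + 1) = 1 := Nat.mod_eq_of_lt (by omega)
    simp [h1] at this
  have h0 : (a i - a (i - 1)) * x i = 0 := by rw [sub_mul, h, sub_self]
  exact (mul_eq_zero.1 h0).resolve_left (sub_ne_zero.2 hne)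

theorem exists_perm_deficiency {V : Type*} [Fintype V] [DecidableEq V] (N : V → Finset V) :
    ∃ (σ : Equiv.Perm V) (A : Finset V), Fintype.card V + (A.biUnion N).card ≤
      (Finset.univ.filter fun v => σ v ∈ N v).card + A.card := by
  classical
  obtain ⟨A, -, hA⟩ := Finset.exists_max_image (Finset.univ : Finset (Finset V))
    (fun A => (A.card : ℤ) - (A.biUnion N).card) Finset.univ_nonempty
  have hA0 : (0 : ℤ) ≤ A.card - (A.biUnion N).card := by simpa using hA ∅ (Finset.mem_univ _)
  set m := A.card - (A.biUnion N).card
  let t : V → Finset (V ⊕ Fin m) := fun v => (N v).disjSum Finset.univ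
  obtain ⟨f, hf, hft⟩ := (Finset.all_card_le_biUnion_card_iff_exists_injective t).1 (by
    intro s
    rcases s.eq_empty_or_nonempty with rfl | ⟨a, ha⟩
    · simp
    have : s.biUnion t = (s.biUnion N).disjSum Finset.univ := by
      ext (x | x)
      · simp [t]
      · simpa [t] using ⟨a, ha⟩
    rw [this, Finset.card_disjSum, Finset.card_univ, Fintype.card_fin]
    have := hA s (Finset.mem_univ _)
    omega)
  let s : Finset V := Finset.univ.filter fun v => (f v).isLeft
  let g : V → V := fun v => (f v).elim id fun _ => v
  have hg : ∀ v ∈ s, f v = Sum.inl (g v) := by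
    intro v hv
    obtain ⟨w, hw⟩ := Sum.isLeft_iff.1 (Finset.mem_filter.1 hv).2
    simp [g, hw]
  obtain ⟨e, he⟩ := Finset.exists_equiv_extend_of_card_eq (t := (Finset.univ : Finset V))
    (Finset.card_univ (α := V)).symm (s := s) (f := g) (Finset.subset_univ _) (by
      intro x hx y hy hxy
      apply hf
      rw [hg x hx, hg y hy, hxy])
  refine ⟨e.trans (Equiv.subtypeUnivEquiv fun _ => Finset.mem_univ _), A, ?_⟩
  have h1 : s.card ≤ (Finset.univ.filter fun v =>
      (e.trans (Equiv.subtypeUnivEquiv fun _ => Finset.mem_univ _)) v ∈ N v).card := by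
    refine Finset.card_le_card fun v hv => ?_
    have h := hft v
    rw [hg v hv, ← he v hv] at h
    simpa [t] using h
  have h2 : (Finset.univ.filter fun v => ¬ (f v).isLeft).card ≤ m := by
    have := Finset.card_le_card_of_injOn (s := Finset.univ.filter fun v => ¬ (f v).isLeft)
      (t := (Finset.univ : Finset (Fin m)).map Function.Embedding.inr) f (by
        intro v hv
        have : (f v).isRight := by simpa using hv
        obtain ⟨w, hw⟩ := Sum.isRight_iff.1 this
        simp [hw]) hf.injOn
    simpa using this
  have h3 := Finset.card_filter_add_card_filter_not (s := (Finset.univ : Finset V))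
    (fun v => (f v).isLeft = true)
  rw [Finset.card_univ] at h3
  change s.card + _ = _ at h3
  omega

theorem card_add_rank_le {F α : Type*} [Field F] [Fintype α] [DecidableEq α]
    (M : Matrix α α F) (A N : Finset α) (h : ∀ i ∈ A, ∀ j ∉ N, M i j = 0) :
    M.rank + A.card ≤ Fintype.card α + N.card := by
  let P : Matrix α ((Aᶜ : Finset α) ⊕ N) F := Matrix.of fun i => Sum.elim
    (fun k => if i = k then 1 else 0) (fun k => if i ∈ A then M i k else 0)
  let Q : Matrix ((Aᶜ : Finset α) ⊕ N) α F := Matrix.of fun k j =>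
    Sum.elim (fun k : (Aᶜ : Finset α) => M k j) (fun k : N => if (k : α) = j then 1 else 0) k
  have hM : M = P * Q := by
    ext i j
    simp only [mul_apply, Fintype.sum_sum_type, P, Q, of_apply, Sum.elim_inl, Sum.elim_inr]
    rw [Finset.sum_coe_sort (Aᶜ) (fun k => (if i = k then (1 : F) else 0) * M k j),
      Finset.sum_coe_sort N
        (fun k => (if i ∈ A then M i k else 0) * (if k = j then (1 : F) else 0))]
    by_cases hi : i ∈ A
    · by_cases hj : j ∈ N
      · simp [hi, hj]
      · simp [hi, hj, h i hi j hj]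
    · simp [hi]
  have h1 : M.rank ≤ Fintype.card ((Aᶜ : Finset α) ⊕ N) := by
    rw [hM]; exact (rank_mul_le_left P Q).trans (rank_le_card_width P)
  simp only [Fintype.card_sum, Fintype.card_coe, Finset.card_compl] at h1
  have := Finset.card_le_univ A
  omega

theorem card_le_rank_map_of_det_ne_zero {R L F α β : Type*} [CommRing R] [IsDomain R]
    [Field L] [Field F]
    [Fintype α] [Fintype β] [DecidableEq β] (M : Matrix α α R) (ι : R →+* L)
    (hι : Function.Injective ι) (φ : R →+* F) (r c : β → α)
    (h : ((M.submatrix r c).map φ).det ≠ 0) : Fintype.card β ≤ (M.map ι).rank := by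
  have h1 : (M.submatrix r c).det ≠ 0 := by
    intro h0
    apply h
    have := φ.map_det (M.submatrix r c)
    rw [h0, map_zero] at this
    exact this.symm
  have h2 : ((M.map ι).submatrix r c).det ≠ 0 := by
    have := ι.map_det (M.submatrix r c)
    intro h0
    exact h1 (hι (by rw [this, map_zero]; exact h0))
  rw [← rank_of_isUnit _ ((Matrix.isUnit_iff_isUnit_det _).2 h2.isUnit)]
  exact rank_submatrix_le _ _ _

theorem two_mul_fracMatching_le {n : ℕ} (G : SimpleGraph (Fin n)) [DecidableRel G.Adj]
    {y : G.edgeSet → ℝ} (hy : IsFracGraphMatching G y) (A N : Finset (Fin n))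
    (hN : ∀ a ∈ A, ∀ b, G.Adj a b → b ∈ N) :
    2 * ∑ e, y e + A.card ≤ n + N.card := by
  have key : ∀ e : G.edgeSet, ∃ a b, G.Adj a b ∧
      (e : Sym2 (Fin n)) = s(a, b) := by
    rintro ⟨e, he⟩
    induction e using Sym2.ind with
    | _ a b => exact ⟨a, b, he, rfl⟩
  have hsum : ∀ (s : Finset (Fin n)) (a b : Fin n), a ≠ b → ∀ r : ℝ,
      ∑ v ∈ s, (if v ∈ s(a, b) then r else 0) =
        (if a ∈ s then r else 0) + (if b ∈ s then r else 0) := by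
    intro s a b hab r
    rw [← Finset.sum_ite_eq' s a (fun _ => r), ← Finset.sum_ite_eq' s b (fun _ => r),
      ← Finset.sum_add_distrib]
    refine Finset.sum_congr rfl fun v _ => ?_
    by_cases ha : v = a
    · subst ha; simp [hab]
    · simp [ha]
  have h1 : ∑ v, ∑ e : G.edgeSet, (if v ∈ (e : Sym2 (Fin n)) then y e else 0) = 2 * ∑ e, y e := by
    rw [Finset.sum_comm, Finset.mul_sum]
    refine Finset.sum_congr rfl fun e _ => ?_
    obtain ⟨a, b, hab, he⟩ := key e
    rw [he, hsum _ _ _ hab.ne]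
    simp [two_mul]
  have h2 : ∑ v ∈ A, ∑ e : G.edgeSet, (if v ∈ (e : Sym2 (Fin n)) then y e else 0) ≤
      ∑ v ∈ N, ∑ e : G.edgeSet, (if v ∈ (e : Sym2 (Fin n)) then y e else 0) := by
    rw [Finset.sum_comm, Finset.sum_comm (s := N)]
    refine Finset.sum_le_sum fun e _ => ?_
    obtain ⟨a, b, hab, he⟩ := key e
    rw [he, hsum _ _ _ hab.ne, hsum _ _ _ hab.ne, add_comm]
    have h0 := hy.1 e
    have ha := fun h => hN a h b hab
    have hb := fun h => hN b h a hab.symm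
    refine add_le_add ?_ ?_
    · by_cases h : b ∈ A
      · simp [h, hb h]
      · simp only [h, if_false]; split_ifs <;> simp [h0]
    · by_cases h : a ∈ A
      · simp [h, ha h]
      · simp only [h, if_false]; split_ifs <;> simp [h0]
  have hcard : ∀ s : Finset (Fin n),
      ∑ v ∈ s, ∑ e : G.edgeSet, (if v ∈ (e : Sym2 (Fin n)) then y e else 0) ≤ s.card := fun s =>
    (Finset.sum_le_card_nsmul s _ 1 fun v _ => hy.2 v).trans_eq (by simp)
  have h3 := hcard N
  have h4 := hcard Aᶜ
  have h5 : ((Aᶜ).card : ℝ) + A.card = n := by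
    exact_mod_cast (Finset.card_compl_add_card A).trans (Fintype.card_fin n)
  rw [← Finset.sum_add_sum_compl A] at h1
  linarith

theorem exists_fracMatching_of_perm {n : ℕ} (G : SimpleGraph (Fin n)) [DecidableRel G.Adj]
    (σ : Equiv.Perm (Fin n)) : ∃ y : G.edgeSet → ℝ, IsFracGraphMatching G y ∧
      2 * ∑ e, y e = (Finset.univ.filter fun v => G.Adj v (σ v)).card := by
  let S := Finset.univ.filter fun v => G.Adj v (σ v)
  have key : ∀ f : Sym2 (Fin n) → ℝ, ∑ e : G.edgeSet, f e *
      ∑ v ∈ S, (if s(v, σ v) = (e : Sym2 (Fin n)) then (1 / 2 : ℝ) else 0) =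
        ∑ v ∈ S, f s(v, σ v) * (1 / 2) := by
    intro f
    simp_rw [Finset.mul_sum]
    rw [Finset.sum_comm]
    refine Finset.sum_congr rfl fun v hv => ?_
    have hv' : s(v, σ v) ∈ G.edgeSet := (Finset.mem_filter.1 hv).2
    rw [Finset.sum_eq_single ⟨s(v, σ v), hv'⟩]
    · simp
    · intro e _ he
      rw [if_neg (fun h => he (Subtype.ext h.symm)), mul_zero]
    · simp
  refine ⟨fun e => ∑ v ∈ S, (if s(v, σ v) = (e : Sym2 (Fin n)) then (1 / 2 : ℝ) else 0),
    ⟨fun e => Finset.sum_nonneg fun v _ => by split_ifs <;> norm_num, fun x => ?_⟩, ?_⟩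
  · have h := key fun e => if x ∈ e then 1 else 0
    simp only [ite_mul, one_mul, zero_mul] at h
    rw [h]
    calc ∑ v ∈ S, (if x ∈ s(v, σ v) then (1 / 2 : ℝ) else 0)
        ≤ ∑ v ∈ S, ((if v = x then (1 / 2 : ℝ) else 0) + if v = σ.symm x then 1 / 2 else 0) := by
          refine Finset.sum_le_sum fun v _ => ?_
          have : (x ∈ s(v, σ v)) ↔ v = x ∨ v = σ.symm x := by
            rw [Sym2.mem_iff, Equiv.eq_symm_apply, eq_comm, eq_comm (a := x)]
          simp only [this]
          split_ifs <;> simp_all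
      _ ≤ 1 / 2 + 1 / 2 := by
          rw [Finset.sum_add_distrib, Finset.sum_ite_eq', Finset.sum_ite_eq']
          refine add_le_add ?_ ?_ <;> split_ifs <;> norm_num
      _ = 1 := by norm_num
  · have h := key fun _ => 1
    simp only [one_mul] at h
    rw [h]
    simp [S]
    ring

/-- The blow-up of the Tutte matrix with its entries in the polynomial ring. -/
def tutteBlowupPoly (K : Type*) [Field K] {n : ℕ} (G : SimpleGraph (Fin n))
    [DecidableRel G.Adj] (d : ℕ) : Matrix (Fin d × Fin n) (Fin d × Fin n)
      (MvPolynomial ((Fin n × Fin n) × Fin d × Fin d) K) :=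
  Matrix.of fun x y =>
    if G.Adj x.2 y.2 then
      if x.2 < y.2 then MvPolynomial.X ((x.2, y.2), x.1, y.1)
      else -MvPolynomial.X ((y.2, x.2), x.1, y.1)
    else 0

theorem tutteBlowup_eq_map {K : Type*} [Field K] {n : ℕ} (G : SimpleGraph (Fin n))
    [DecidableRel G.Adj] (d : ℕ) :
    tutteBlowup (K := K) G d = (tutteBlowupPoly K G d).map
      (algebraMap (MvPolynomial ((Fin n × Fin n) × Fin d × Fin d) K) (FFG K n d)) := by
  ext ⟨p, v⟩ ⟨q, w⟩
  have hw : ∀ i j : Fin n, wedge (Pi.single i (1 : K)) (Pi.single j 1) v w =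
      (if v = i ∧ w = j then 1 else 0) - (if v = j ∧ w = i then 1 else 0) := by
    intro i j
    simp [wedge, vecMulVec_apply, Pi.single_apply, ← ite_and, and_comm]
  have hterm : ∀ ij : Fin n × Fin n, (if ij.1 < ij.2 ∧ G.Adj ij.1 ij.2 then
      kroneckerMap (· * ·)
        (Matrix.of fun p q : Fin d =>
          algebraMap (MvPolynomial ((Fin n × Fin n) × Fin d × Fin d) K) (FFG K n d)
            (MvPolynomial.X (ij, p, q)))
        ((wedge (Pi.single ij.1 (1 : K)) (Pi.single ij.2 (1 : K))).map
          ((algebraMap (MvPolynomial ((Fin n × Fin n) × Fin d × Fin d) K)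
            (FFG K n d)).comp MvPolynomial.C))
      else 0) (p, v) (q, w) = if ij.1 < ij.2 ∧ G.Adj ij.1 ij.2 then
        algebraMap (MvPolynomial ((Fin n × Fin n) × Fin d × Fin d) K) (FFG K n d)
            (MvPolynomial.X (ij, p, q)) *
          ((if ij = (v, w) then 1 else 0) - (if ij = (w, v) then 1 else 0)) else 0 := by
    rintro ⟨i, j⟩
    have e1 : (i, j) = (v, w) ↔ v = i ∧ w = j := by rw [Prod.mk_inj, eq_comm, eq_comm (a := j)]
    have e2 : (i, j) = (w, v) ↔ v = j ∧ w = i := by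
      rw [Prod.mk_inj, eq_comm, eq_comm (a := j), and_comm]
    by_cases h : i < j ∧ G.Adj i j
    · rw [if_pos h, if_pos h, kroneckerMap_apply, Matrix.map_apply, hw, of_apply]
      simp only [e1, e2]
      congr 1
      split_ifs <;> simp
    · rw [if_neg h, if_neg h, Matrix.zero_apply]
  rw [tutteBlowup, Matrix.sum_apply, Finset.sum_congr rfl fun ij _ => hterm ij]
  have hsplit : ∀ ij : Fin n × Fin n, (if ij.1 < ij.2 ∧ G.Adj ij.1 ij.2 then
        algebraMap (MvPolynomial ((Fin n × Fin n) × Fin d × Fin d) K) (FFG K n d)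
            (MvPolynomial.X (ij, p, q)) *
          ((if ij = (v, w) then 1 else 0) - (if ij = (w, v) then 1 else 0)) else 0) =
      (if ij = (v, w) then (if ij.1 < ij.2 ∧ G.Adj ij.1 ij.2 then
        algebraMap (MvPolynomial ((Fin n × Fin n) × Fin d × Fin d) K) (FFG K n d)
            (MvPolynomial.X (ij, p, q)) else 0) else 0) -
      (if ij = (w, v) then (if ij.1 < ij.2 ∧ G.Adj ij.1 ij.2 then
        algebraMap (MvPolynomial ((Fin n × Fin n) × Fin d × Fin d) K) (FFG K n d)
            (MvPolynomial.X (ij, p, q)) else 0) else 0) := by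
    intro ij
    split_ifs <;> ring
  rw [Finset.sum_congr rfl fun ij _ => hsplit ij, Finset.sum_sub_distrib,
    Finset.sum_ite_eq', Finset.sum_ite_eq']
  simp only [Finset.mem_univ, if_true, tutteBlowupPoly, Matrix.map_apply, Matrix.of_apply]
  by_cases hvw : G.Adj v w
  · rcases lt_or_gt_of_ne hvw.ne with h | h
    · simp [hvw, h, h.not_gt]
    · simp [hvw, hvw.symm, h, h.not_gt]
  · simp [hvw, mt G.adj_symm hvw]

theorem sum_ite_mulVec {R ι κ : Type*} [CommRing R] [Fintype ι] [Fintype κ] [DecidableEq κ]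
    (M : Matrix ι ι R) (u : κ → ι → R) (i : κ) :
    ∑ j, (if j = i then M else 0) *ᵥ u j = M *ᵥ u i := by
  rw [Finset.sum_eq_single i] <;> simp +contextual

theorem mul_card_le_rank_tutteBlowup {K : Type*} [Field K] {n : ℕ} (G : SimpleGraph (Fin n))
    [DecidableRel G.Adj] (d : ℕ) (hd : 3 ≤ n → 2 ≤ d) (σ : Equiv.Perm (Fin n)) :
    d * (Finset.univ.filter fun v => G.Adj v (σ v)).card ≤ (tutteBlowup (K := K) G d).rank := by
  classical
  set S := Finset.univ.filter fun v => G.Adj v (σ v)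
  have hS : ∀ v, v ∈ S ↔ G.Adj v (σ v) := by simp [S]
  obtain ⟨B, D, hBD⟩ := exists_commutator_injective (F := AlgebraicClosure K) d
  obtain ⟨A, hA0, hA1, hA⟩ := exists_arc_weights σ (S : Set (Fin n))
    (fun v hv => ((hS v).1 hv).ne') B D (fun h => hBD (hd (by simpa using h)))
  let X : Fin n → Fin n → Matrix (Fin d) (Fin d) (AlgebraicClosure K) := fun i j =>
    if σ i = j then A i else if σ j = i then -A j else 0
  let φ : MvPolynomial ((Fin n × Fin n) × Fin d × Fin d) K →+* AlgebraicClosure K :=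
    MvPolynomial.eval₂Hom (algebraMap K _) fun e => X e.1.1 e.1.2 e.2.1 e.2.2
  let Bl : Fin n → Fin n → Matrix (Fin d) (Fin d) (AlgebraicClosure K) := fun v j =>
    if G.Adj v j then if v < j then X v j else -X j v else 0
  have hφ : ∀ p v q j, φ (tutteBlowupPoly K G d (p, v) (q, j)) = Bl v j p q := by
    intro p v q j
    simp only [tutteBlowupPoly, of_apply, Bl]
    split_ifs <;> simp [φ]
  have hBl : ∀ v ∈ S, σ (σ v) ≠ v → ∀ j, Bl v j =
      (if j = σ v then A v else 0) - (if j = σ.symm v then A (σ.symm v) else 0) := by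
    intro v hv h2 j
    have hne : σ.symm v ≠ σ v := fun h => h2 (by rw [← h, Equiv.apply_symm_apply])
    by_cases hj : j = σ v
    · subst hj
      simp only [Bl, X, (hS v).1 hv, if_true, if_neg h2, if_neg hne.symm,
        sub_zero, neg_neg, ite_self]
    · by_cases hj' : j = σ.symm v
      · subst hj'
        by_cases hs : σ.symm v ∈ S
        · have hadj := ((hS _).1 hs).symm
          rw [Equiv.apply_symm_apply] at hadj
          simp [Bl, X, hadj, hne, hne.symm]
        · have hadj : ¬ G.Adj v (σ.symm v) := fun h => hs ((hS _).2 (by simpa using h.symm))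
          simp [Bl, hadj, hne, hA0 _ hs]
      · have h1 : σ v ≠ j := Ne.symm hj
        have h3 : σ j ≠ v := fun h => hj' (by rw [← h, Equiv.symm_apply_apply])
        simp [Bl, X, hj, hj', h1, h3]
  have hBl2 : ∀ v ∈ S, σ (σ v) = v → ∃ s : AlgebraicClosure K, s ≠ 0 ∧ ∀ j, Bl v j =
      if j = σ v then s • 1 else 0 := by
    intro v hv h2
    refine ⟨if v < σ v then 1 else -1, by split_ifs <;> simp, fun j => ?_⟩
    by_cases hj : j = σ v
    · subst hj
      have hs : σ v ∈ S := (hS _).2 (by rw [h2]; exact ((hS v).1 hv).symm)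
      simp only [Bl, X, (hS v).1 hv, if_true, h2, hA1 v hv h2, hA1 (σ v) hs (by rw [h2])]
      split_ifs <;> simp
    · have h1 : σ v ≠ j := Ne.symm hj
      have h3 : σ j ≠ v := fun h => h1 (σ.injective (h2.trans h.symm))
      simp [Bl, X, hj, h1, h3]
  rw [tutteBlowup_eq_map]
  have := card_le_rank_map_of_det_ne_zero (β := Fin d × S) (tutteBlowupPoly K G d)
    (algebraMap _ (FFG K n d)) (IsFractionRing.injective _ _) φ
    (fun x => (x.1, (x.2 : Fin n))) (fun x => (x.1, σ x.2)) ?_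
  · simpa using this
  rw [Ne, ← Matrix.exists_mulVec_eq_zero_iff]
  rintro ⟨w, hw0, hw⟩
  let w' : Fin d → Fin n → AlgebraicClosure K := fun q v =>
    if h : v ∈ S then w (q, ⟨v, h⟩) else 0
  let u : Fin n → Fin d → AlgebraicClosure K := fun v q => w' q (σ.symm v)
  have hrow : ∀ v ∈ S, ∑ j, Bl v j *ᵥ u j = 0 := by
    intro v hv
    funext p
    have h := congrFun hw (p, ⟨v, hv⟩)
    simp only [mulVec, dotProduct, Matrix.map_apply, submatrix_apply, hφ,
      Fintype.sum_prod_type_right] at h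
    rw [Finset.sum_apply, ← Equiv.sum_comp σ]
    refine Eq.trans ?_ h
    have e1 : ∀ j : S, ∀ q, w (q, j) = w' q j := fun j q => by simp [w']
    simp only [e1]
    rw [Finset.sum_coe_sort S (fun j => ∑ q, Bl v (σ j) p q * w' q j)]
    symm
    refine (Finset.sum_subset (Finset.subset_univ S) fun j _ hj => ?_).trans ?_
    · simp [w', hj]
    · simp [mulVec, dotProduct, u]
  have hu : u = 0 := by
    apply hA
    · intro v hv
      funext q
      have : v ∉ S := hv
      simp [u, w', this]
    · intro v hv h2
      obtain ⟨s, hs, hB⟩ := hBl2 v hv h2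
      have := hrow v hv
      simp only [hB, sum_ite_mulVec, smul_mulVec, one_mulVec] at this
      exact (smul_eq_zero.1 this).resolve_left hs
    · intro v hv h2
      have := hrow v hv
      simp only [hBl v hv h2, sub_mulVec, Finset.sum_sub_distrib, sum_ite_mulVec] at this
      exact sub_eq_zero.1 this
  apply hw0
  funext ⟨q, v, hv⟩
  have := congrFun (congrFun hu (σ v)) q
  simpa [u, w', hv] using this

theorem rank_tutteBlowup_add_le {K : Type*} [Field K] {n : ℕ} (G : SimpleGraph (Fin n))
    [DecidableRel G.Adj] (d : ℕ) (A N : Finset (Fin n)) (hN : ∀ a ∈ A, ∀ b, G.Adj a b → b ∈ N) :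
    (tutteBlowup (K := K) G d).rank + d * A.card ≤ d * (n + N.card) := by
  have := card_add_rank_le (tutteBlowup (K := K) G d) (Finset.univ ×ˢ A) (Finset.univ ×ˢ N) (by
    rintro ⟨p, v⟩ hv ⟨q, w⟩ hw
    have hvw : ¬ G.Adj v w := fun h => hw (by simpa using hN v (by simpa using hv) w h)
    simp [tutteBlowup_eq_map, tutteBlowupPoly, hvw])
  simpa [mul_add] using this

/-- For a loopless graph `G` and `d ≥ n − 1`, the rank of the `d`-th order blow-up of the
Tutte matrix equals `2d` times the maximum cardinality of a fractional matching of `G`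
(equivalently, the nc-rank of the Tutte matrix is twice the maximum fractional matching). -/
theorem rank_tutteBlowup_eq_two_d_mul_max_fracMatching
    {K : Type*} [Field K] {n : ℕ} (hn : 0 < n)
    (G : SimpleGraph (Fin n)) [DecidableRel G.Adj]
    (d : ℕ) (hd1 : 1 ≤ d) (hd : n - 1 ≤ d) :
    (((tutteBlowup (K := K) G d).rank : ℝ)) =
      2 * d * sSup {r : ℝ | ∃ y : G.edgeSet → ℝ, IsFracGraphMatching G y ∧
        r = ∑ e : G.edgeSet, y e} := by
  classical
  obtain ⟨σ, A, hσ⟩ := exists_perm_deficiency fun v => Finset.univ.filter fun w => G.Adj v w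
  set N := A.biUnion fun v => Finset.univ.filter fun w => G.Adj v w
  have hN : ∀ a ∈ A, ∀ b, G.Adj a b → b ∈ N := fun a ha b hab => by
    simpa [N] using ⟨a, ha, hab⟩
  simp only [Fintype.card_fin, Finset.mem_filter, Finset.mem_univ, true_and] at hσ
  set s := (Finset.univ.filter fun v => G.Adj v (σ v)).card with hs
  have hlow : d * s ≤ _ := mul_card_le_rank_tutteBlowup (K := K) G d (fun h => by omega) σ
  have hupp := rank_tutteBlowup_add_le (K := K) G d A N hN
  have hrank : (tutteBlowup (K := K) G d).rank = d * s := by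
    have := Nat.mul_le_mul_left d hσ
    rw [mul_add d s] at this
    omega
  obtain ⟨y, hy, hys⟩ := exists_fracMatching_of_perm G σ
  have hgreatest : IsGreatest {r : ℝ | ∃ y : G.edgeSet → ℝ, IsFracGraphMatching G y ∧
      r = ∑ e : G.edgeSet, y e} (s / 2 : ℝ) := by
    refine ⟨⟨y, hy, by rw [← hs] at hys; linarith⟩, ?_⟩
    rintro r ⟨z, hz, rfl⟩
    have h1 := two_mul_fracMatching_le G hz A N hN
    have h2 : (n : ℝ) + N.card ≤ s + A.card := by exact_mod_cast hσ
    linarith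
  rw [hgreatest.csSup_eq, hrank]
  push_cast
  ring
end
end

section
/- Let (S, T) be a nested 2-cover for the lines ℓ_1,…,ℓ_m. Then for every integer d ≥ 1, the d-th order blow-up of the matrix representation satisfies rank A^{(d)} ≤ d·(dim S + dim T). (In particular, the non-commutative rank of A is at most dim S + dim T.) -/
open Matrix

noncomputable section

theorem exists_rank_factorization_of_isCompl {K : Type*} [Field K] {n : ℕ}
    {S N : Submodule K (Fin n → K)} (h : IsCompl S N) :
    ∃ (U : Matrix (Fin n) (Fin (Module.finrank K S)) K)
      (V : Matrix (Fin (Module.finrank K S)) (Fin n) K),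
      (∀ x ∈ S, (U * V) *ᵥ x = x) ∧ ∀ x ∈ N, (U * V) *ᵥ x = 0 := by
  let e := (Module.finBasis K S).equivFun
  refine ⟨LinearMap.toMatrix' (S.subtype ∘ₗ e.symm.toLinearMap),
    LinearMap.toMatrix' (e.toLinearMap ∘ₗ S.projectionOnto N h), ?_, ?_⟩
  · intro x hx
    rw [← LinearMap.toMatrix'_comp, LinearMap.toMatrix'_mulVec]
    have := Submodule.projectionOnto_apply_left h ⟨x, hx⟩
    simp_all
  · intro x hx
    rw [← LinearMap.toMatrix'_comp, LinearMap.toMatrix'_mulVec]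
    have := (Submodule.projectionOnto_apply_eq_zero_iff h).2 hx
    simp_all

theorem mul_wedge {K : Type*} [Field K] {n : ℕ} (M : Matrix (Fin n) (Fin n) K)
    (x y : Fin n → K) :
    M * wedge x y = vecMulVec (M *ᵥ x) y - vecMulVec (M *ᵥ y) x := by
  simp [wedge, Matrix.mul_sub, Matrix.mul_vecMulVec]

theorem mul_wedge_mul_transpose {K : Type*} [Field K] {n : ℕ} (M : Matrix (Fin n) (Fin n) K)
    (x y : Fin n → K) :
    M * wedge x y * Mᵀ = wedge (M *ᵥ x) (M *ᵥ y) := by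
  simp [wedge, Matrix.mul_sub, Matrix.sub_mul, Matrix.mul_vecMulVec, Matrix.vecMulVec_mul,
    Matrix.vecMul_transpose]

theorem wedge_eq_zero_of_smul_add_smul_eq_zero {K : Type*} [Field K] {n : ℕ} {x y : Fin n → K}
    {α β : K} (hne : α ≠ 0 ∨ β ≠ 0) (h : α • x + β • y = 0) : wedge x y = 0 := by
  have h' (i : Fin n) : α * x i + β * y i = 0 := by simpa using congrFun h i
  ext i j
  simp only [wedge, Matrix.sub_apply, vecMulVec_apply, Matrix.zero_apply]
  rcases hne with hα | hβ
  · apply mul_left_cancel₀ hα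
    linear_combination y j * h' i - y i * h' j
  · apply mul_left_cancel₀ hβ
    linear_combination x i * h' j - x j * h' i

/-- A nested 2-cover contains each line in `T` or meets it nontrivially in `S`. -/
theorem line_le_or_exists_mem_of_two_cover {K : Type*} [Field K] {n : ℕ} (a b : Fin n → K)
    (S T : Submodule K (Fin n → K))
    (h : 2 ≤ Module.finrank K ↥(S ⊓ line a b) + Module.finrank K ↥(T ⊓ line a b)) :
    (a ∈ T ∧ b ∈ T) ∨ ∃ α β : K, (α ≠ 0 ∨ β ≠ 0) ∧ α • a + β • b ∈ S := by
  by_cases hS : S ⊓ line a b = ⊥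
  · left
    rw [hS, finrank_bot, zero_add] at h
    have hle : Module.finrank K ↥(line a b) ≤ 2 := by
      classical
      have h₂ := (finrank_span_finset_le_card (R := K) ({a, b} : Finset (Fin n → K))).trans
        Finset.card_le_two
      rwa [Set.finrank, Finset.coe_pair] at h₂
    have heq : T ⊓ line a b = line a b :=
      Submodule.eq_of_le_of_finrank_le inf_le_right (hle.trans h)
    have hT : line a b ≤ T := inf_eq_right.1 heq
    exact ⟨hT (Submodule.subset_span (by simp)), hT (Submodule.subset_span (by simp))⟩
  · right
    obtain ⟨u, hu, hu0⟩ := Submodule.exists_mem_ne_zero_of_ne_bot hS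
    obtain ⟨α, β, rfl⟩ := Submodule.mem_span_pair.1 hu.2
    refine ⟨α, β, ?_, hu.1⟩
    by_contra! hc
    simp [hc.1, hc.2] at hu0

theorem matrix_rank_add_le {F ι κ : Type*} [Field F] [Fintype ι] [Fintype κ]
    (A B : Matrix ι κ F) : (A + B).rank ≤ A.rank + B.rank := by
  rw [Matrix.rank, Matrix.mulVecLin_add]
  exact (Submodule.finrank_mono (LinearMap.range_add_le _ _)).trans
    (Submodule.finrank_add_le_finrank_add_finrank _ _)

theorem rank_one_kronecker_mul_map_le {K F ι : Type*} [Field K] [Field F] [Fintype ι]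
    [DecidableEq ι] {n r : ℕ} (φ : K →+* F)
    (U : Matrix (Fin n) (Fin r) K) (V : Matrix (Fin r) (Fin n) K) :
    (kroneckerMap (· * ·) (1 : Matrix ι ι F) ((U * V).map φ)).rank ≤ Fintype.card ι * r := by
  have : kroneckerMap (· * ·) (1 : Matrix ι ι F) ((U * V).map φ) =
      kroneckerMap (· * ·) (1 : Matrix ι ι F) (U.map φ) *
        kroneckerMap (· * ·) (1 : Matrix ι ι F) (V.map φ) := by
    rw [← Matrix.mul_kronecker_mul, one_mul, Matrix.map_mul]
  rw [this]
  refine (Matrix.rank_mul_le_left _ _).trans ((Matrix.rank_le_card_width _).trans ?_)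
  simp

/-- If each wedge satisfies `W = P W + E W Q + R Y`, so does the blow-up, with the outer
factors acting blockwise. -/
theorem blowup_eq_of_wedge_eq {K : Type*} [Field K] {n m : ℕ} (a b : Fin m → Fin n → K) (d : ℕ)
    (P E Q R : Matrix (Fin n) (Fin n) K) (Y : Fin m → Matrix (Fin n) (Fin n) K)
    (h : ∀ i, wedge (a i) (b i) = P * wedge (a i) (b i) + E * wedge (a i) (b i) * Q + R * Y i) :
    ∃ B C D : Matrix (Fin d × Fin n) (Fin d × Fin n) (FF K m d),
      blowup a b d =
        kroneckerMap (· * ·) (1 : Matrix (Fin d) (Fin d) (FF K m d)) (P.map (toFF K m d)) * B +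
        C * kroneckerMap (· * ·) (1 : Matrix (Fin d) (Fin d) (FF K m d)) (Q.map (toFF K m d)) +
        kroneckerMap (· * ·) (1 : Matrix (Fin d) (Fin d) (FF K m d)) (R.map (toFF K m d)) * D := by
  let X (i : Fin m) : Matrix (Fin d) (Fin d) (FF K m d) := Matrix.of fun p q =>
    algebraMap (MvPolynomial (Fin m × Fin d × Fin d) K) (FF K m d) (MvPolynomial.X (i, p, q))
  refine ⟨blowup a b d,
    ∑ i, kroneckerMap (· * ·) (X i) ((E * wedge (a i) (b i)).map (toFF K m d)),
    ∑ i, kroneckerMap (· * ·) (X i) ((Y i).map (toFF K m d)), ?_⟩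
  simp only [blowup, Finset.mul_sum, Finset.sum_mul, ← Finset.sum_add_distrib]
  refine Finset.sum_congr rfl fun i _ => ?_
  change kroneckerMap (· * ·) (X i) _ = _ * kroneckerMap (· * ·) (X i) _ + _ + _
  rw [← Matrix.mul_kronecker_mul, ← Matrix.mul_kronecker_mul, ← Matrix.mul_kronecker_mul,
    one_mul, mul_one, ← Matrix.map_mul, ← Matrix.map_mul, ← Matrix.map_mul,
    ← Matrix.kronecker_add, ← Matrix.kronecker_add,
    ← Matrix.map_add _ (map_add _), ← Matrix.map_add _ (map_add _), ← h i]

/-- If `(S, T)` is a nested 2-cover for the lines `ℓᵢ = span {aᵢ, bᵢ}`, then for every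
`d ≥ 1`, `rank A^{(d)} ≤ d (dim S + dim T)`. -/
theorem rank_blowup_le_of_nested_two_cover
    {K : Type*} [Field K] {n m : ℕ} (hn : 0 < n) (hm : 0 < m)
    (a b : Fin m → Fin n → K) (hab : ∀ i, LinearIndependent K ![a i, b i])
    (S T : Submodule K (Fin n → K)) (hST : S ≤ T)
    (hcover : ∀ i, 2 ≤ Module.finrank K ↥(S ⊓ line (a i) (b i)) +
      Module.finrank K ↥(T ⊓ line (a i) (b i)))
    (d : ℕ) (hd : 1 ≤ d) :
    (blowup a b d).rank ≤ d * (Module.finrank K ↥S + Module.finrank K ↥T) := by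
  obtain ⟨N, hN⟩ := Submodule.exists_isCompl S
  obtain ⟨N', hN'⟩ := Submodule.exists_isCompl (N ⊓ T)
  obtain ⟨U, V, hPS, hPN⟩ := exists_rank_factorization_of_isCompl hN
  obtain ⟨U', V', hR, -⟩ := exists_rank_factorization_of_isCompl hN'
  have hsup : S ⊔ N ⊓ T = T := by
    rw [← sup_inf_assoc_of_le N hST, hN.sup_eq_top, top_inf_eq]
  have hdim : Module.finrank K ↥S + Module.finrank K ↥(N ⊓ T) = Module.finrank K ↥T := by
    have h := Submodule.finrank_sup_add_finrank_inf_eq S (N ⊓ T)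
    rw [hsup, ← inf_assoc, hN.inf_eq_bot, bot_inf_eq, finrank_bot] at h
    omega
  set P := U * V with hP
  set R := U' * V'
  have hES (x) (hx : x ∈ S) : (1 - P) *ᵥ x = 0 := by
    rw [Matrix.sub_mulVec, Matrix.one_mulVec, hPS x hx, sub_self]
  have hRE (x) (hx : x ∈ T) : R *ᵥ ((1 - P) *ᵥ x) = (1 - P) *ᵥ x := by
    rw [← hsup] at hx
    obtain ⟨s, hs, t, ht, rfl⟩ := Submodule.mem_sup.1 hx
    have h : (1 - P) *ᵥ t = t := by
      rw [Matrix.sub_mulVec, Matrix.one_mulVec, hPN t ht.1, sub_zero]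
    rw [Matrix.mulVec_add, hES s hs, zero_add, h, hR t ht]
  have hW (i) : R * ((1 - P) * wedge (a i) (b i) * (1 - P)ᵀ) =
      (1 - P) * wedge (a i) (b i) * (1 - P)ᵀ := by
    rw [mul_wedge_mul_transpose]
    rcases line_le_or_exists_mem_of_two_cover _ _ S T (hcover i) with ⟨ha, hb⟩ | ⟨α, β, hne, hu⟩
    · rw [mul_wedge, hRE _ ha, hRE _ hb, wedge]
    · rw [wedge_eq_zero_of_smul_add_smul_eq_zero hne, mul_zero]
      rw [← Matrix.mulVec_smul, ← Matrix.mulVec_smul, ← Matrix.mulVec_add, hES _ hu]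
  obtain ⟨B, C, D, hBCD⟩ := blowup_eq_of_wedge_eq a b d P (1 - P) Pᵀ R
    (fun i => (1 - P) * wedge (a i) (b i) * (1 - P)ᵀ) fun i => by
      rw [hW i, Matrix.transpose_sub, Matrix.transpose_one]
      noncomm_ring
  have hr₁ := rank_one_kronecker_mul_map_le (ι := Fin d) (toFF K m d) U V
  have hr₂ := rank_one_kronecker_mul_map_le (ι := Fin d) (toFF K m d) Vᵀ Uᵀ
  have hr₃ := rank_one_kronecker_mul_map_le (ι := Fin d) (toFF K m d) U' V'
  rw [← Matrix.transpose_mul, ← hP] at hr₂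
  rw [Fintype.card_fin] at hr₁ hr₂ hr₃
  rw [hBCD]
  calc _ ≤ d * Module.finrank K ↥S + d * Module.finrank K ↥S + d * Module.finrank K ↥(N ⊓ T) :=
        (matrix_rank_add_le _ _).trans (add_le_add ((matrix_rank_add_le _ _).trans (add_le_add
          ((Matrix.rank_mul_le_left _ _).trans hr₁) ((Matrix.rank_mul_le_right _ _).trans hr₂)))
          ((Matrix.rank_mul_le_left _ _).trans hr₃))
    _ = _ := by rw [← hdim]; ring
end
end
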